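/- arXiv:1405.2946 — 2 statements merged into one kernel-verified Lean document; each statement's English description precedes it below -/
import Mathlib

section
/- Let μ : [0,∞) → [1,∞) be a differentiable growth rate with K_μ := sup_{t ≥ 0} μ'(t)/μ(t) < +∞. Let U : Δ → B(X) be an evolution operator and P a projection valued function compatible with U such that ‖G(t,s)‖ ≤ M (μ'(s)/μ(s)) (μ(t)/μ(s))^{ω·sign(t−s)} μ(s)^α for all t,s ≥ 0 with t ≠ s, for some ω > 0, α ≥ 0 and M ≥ 1. Suppose there exist p ≥ 1 and γ > α such that for every H ∈ H^μ_{γ,p}(P) there exist ε ≥ 0, D > 0 and a function L : [0,∞) × X → ℝ satisfying, for all t ≥ s ≥ 0 and x ∈ X: (i) L(t, U(t,s)x) + ∫_s^t ‖H(τ)U(τ,s)x‖^p dτ ≤ L(s,x); (ii) L(t,P(t)x) ≥ 0 and L(t,Q(t)x) ≤ 0; (iii) μ(t)^{−pγ} L(t,P(t)x) − μ(t)^{pγ} L(t,Q(t)x) ≤ 2^{p−1} D μ(t)^{pε} ‖x‖^p. Then U has a nonuniform μ-dichotomy with projection valued function P. -/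
open Real MeasureTheory Filter

noncomputable section

/-- A growth rate: an increasing function `μ : [0,∞) → [1,∞)` with `μ 0 = 1` and
`μ t → ∞` as `t → ∞`. -/
def IsGrowthRate (μ : ℝ → ℝ) : Prop :=
  (∀ t, 0 ≤ t → 1 ≤ μ t) ∧ MonotoneOn μ (Set.Ici 0) ∧ μ 0 = 1 ∧
    Filter.Tendsto μ Filter.atTop Filter.atTop

variable {X : Type*} [NormedAddCommGroup X] [NormedSpace ℝ X]

/-- An evolution operator on `X`. -/
def IsEvolutionOperator (U : ℝ → ℝ → X →L[ℝ] X) : Prop :=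
  (∀ t, 0 ≤ t → U t t = 1) ∧
  (∀ s τ t, 0 ≤ s → s ≤ τ → τ ≤ t → (U t τ).comp (U τ s) = U t s) ∧
  (∀ x : X, ContinuousOn (fun q : ℝ × ℝ => U q.1 q.2 x) {q : ℝ × ℝ | 0 ≤ q.2 ∧ q.2 ≤ q.1})

/-- A (strongly continuous) projection valued function. -/
def IsProjectionValued (P : ℝ → X →L[ℝ] X) : Prop :=
  (∀ t, 0 ≤ t → (P t).comp (P t) = P t) ∧
  (∀ x : X, ContinuousOn (fun t => P t x) (Set.Ici 0))

/-- `P` is compatible with the evolution operator `U`; `V s t` plays the role of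
`U_Q(s,t)`, the inverse of the restriction `U(t,s)|_{Q(s)X} : Q(s)X → Q(t)X`,
where `Q t = 1 - P t`. -/
def CompatibleProjection (U V : ℝ → ℝ → X →L[ℝ] X) (P : ℝ → X →L[ℝ] X) : Prop :=
  (∀ s t, 0 ≤ s → s ≤ t → (P t).comp (U t s) = (U t s).comp (P s)) ∧
  (∀ s t, 0 ≤ s → s ≤ t → ∀ x : X,
    (1 - P s) (V s t ((1 - P t) x)) = V s t ((1 - P t) x)) ∧
  (∀ s t, 0 ≤ s → s ≤ t → ∀ x : X, U t s (V s t ((1 - P t) x)) = (1 - P t) x) ∧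
  (∀ s t, 0 ≤ s → s ≤ t → ∀ x : X, V s t (U t s ((1 - P s) x)) = (1 - P s) x)

/-- Nonuniform μ-dichotomy. -/
def NonuniformMuDichotomy (μ : ℝ → ℝ) (U V : ℝ → ℝ → X →L[ℝ] X)
    (P : ℝ → X →L[ℝ] X) : Prop :=
  ∃ a b ε N₁ N₂ : ℝ, 0 < a ∧ 0 < b ∧ 0 ≤ ε ∧ 1 ≤ N₁ ∧ 1 ≤ N₂ ∧
    ∀ s t, 0 ≤ s → s ≤ t →
      ‖(U t s).comp (P s)‖ ≤ N₁ * (μ t / μ s) ^ (-a) * μ s ^ ε ∧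
      ‖(V s t).comp (1 - P t)‖ ≤ N₂ * (μ t / μ s) ^ (-b) * μ t ^ ε

/-- Uniform μ-dichotomy (the case ε = 0). -/
def UniformMuDichotomy (μ : ℝ → ℝ) (U V : ℝ → ℝ → X →L[ℝ] X)
    (P : ℝ → X →L[ℝ] X) : Prop :=
  ∃ a b N₁ N₂ : ℝ, 0 < a ∧ 0 < b ∧ 1 ≤ N₁ ∧ 1 ≤ N₂ ∧
    ∀ s t, 0 ≤ s → s ≤ t →
      ‖(U t s).comp (P s)‖ ≤ N₁ * (μ t / μ s) ^ (-a) ∧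
      ‖(V s t).comp (1 - P t)‖ ≤ N₂ * (μ t / μ s) ^ (-b)

/-- The Green function associated to `U` and `P`:
`G(t,s) = U(t,s)P(s)` for `t > s` and `G(t,s) = -U_Q(t,s)Q(s)` for `t < s`. -/
def greenFunction (U V : ℝ → ℝ → X →L[ℝ] X) (P : ℝ → X →L[ℝ] X) (t s : ℝ) :
    X →L[ℝ] X :=
  if s < t then (U t s).comp (P s)
  else if t < s then -((V t s).comp (1 - P s))
  else 0

/-- Membership in the class `H^μ_{γ,p}(P)`. -/
def MemHClass (μ : ℝ → ℝ) (P : ℝ → X →L[ℝ] X) (γ p : ℝ) (H : ℝ → X →L[ℝ] X) : Prop :=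
  (∀ x : X, ContinuousOn (fun t => H t x) (Set.Ici 0)) ∧
  (∀ t, 0 ≤ t → ∀ x : X,
    ‖H t x‖ ≤ (deriv μ t / μ t) ^ (1 / p) * μ t ^ γ * ‖P t x‖ +
      (deriv μ t / μ t) ^ (1 / p) * μ t ^ (-γ) * ‖(1 - P t) x‖)



lemma aux_inf (lam : ℝ → ℝ) (K : ℝ) (h0 : ∀ y, 0 ≤ lam y) (hK : ∀ y, lam y ≤ K) :
    ∃ hh : ℕ → ℝ → ℝ, (∀ n, Continuous (hh n)) ∧ (∀ τ, Monotone (fun n => hh n τ)) ∧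
      (∀ n τ, 0 ≤ hh n τ ∧ hh n τ ≤ lam τ) ∧
      (∀ (n : ℕ) τ, ∃ y, |τ - y| ≤ (K + 1) / ((n : ℝ) + 1) ∧ lam y ≤ hh n τ + 1 / ((n : ℝ) + 1)) := by
  have hbd : ∀ (n : ℕ) τ, BddBelow (Set.range fun y => lam y + ((n : ℝ) + 1) * |τ - y|) := by
    intro n τ
    refine ⟨0, ?_⟩
    rintro _ ⟨y, rfl⟩
    have := h0 y
    positivity
  refine ⟨fun n τ => ⨅ y, (lam y + ((n : ℝ) + 1) * |τ - y|), ?_, ?_, ?_, ?_⟩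
  · intro n
    have : LipschitzWith ((n : NNReal) + 1) (fun τ => ⨅ y, (lam y + ((n : ℝ) + 1) * |τ - y|)) := by
      apply LipschitzWith.of_le_add_mul
      intro a b
      have : (⨅ y, (lam y + ((n : ℝ) + 1) * |a - y|)) - ((n : ℝ) + 1) * dist a b ≤
        ⨅ y, (lam y + ((n : ℝ) + 1) * |b - y|) := by
        apply le_ciInf
        intro y
        have h1 := ciInf_le (hbd n a) y
        have h2 : |a - y| ≤ dist a b + |b - y| := by
          rw [Real.dist_eq]; exact abs_sub_le a b y
        have h3 : (0:ℝ) ≤ (n : ℝ) + 1 := by positivity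
        nlinarith [mul_le_mul_of_nonneg_left h2 h3]
      push_cast
      linarith
    exact this.continuous
  · intro τ n m hnm
    apply ciInf_mono (hbd n τ)
    intro y
    have : (n : ℝ) ≤ m := by exact_mod_cast hnm
    gcongr
  · intro n τ
    refine ⟨Real.iInf_nonneg fun y => add_nonneg (h0 y) (by positivity), ?_⟩
    have h1 := ciInf_le (hbd n τ) τ
    simpa using h1
  · intro n τ
    have hpos : (0:ℝ) < (n : ℝ) + 1 := by positivity
    obtain ⟨y, hy⟩ := exists_lt_of_ciInf_lt (show (⨅ y, (lam y + ((n : ℝ) + 1) * |τ - y|)) <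
      (⨅ y, (lam y + ((n : ℝ) + 1) * |τ - y|)) + 1 / ((n : ℝ) + 1) by
        have : 0 < 1 / ((n : ℝ) + 1) := by positivity
        linarith)
    have h1 := ciInf_le (hbd n τ) τ
    simp only [sub_self, abs_zero, mul_zero, add_zero] at h1
    refine ⟨y, ?_, ?_⟩
    · rw [le_div_iff₀ hpos]
      have h2 : 1 / ((n : ℝ) + 1) ≤ 1 := by
        rw [div_le_one hpos]; linarith [(Nat.cast_nonneg n : (0:ℝ) ≤ n)]
      have := h0 y
      have := hK τ
      nlinarith
    · have : 0 ≤ ((n : ℝ) + 1) * |τ - y| := by positivity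
      linarith

lemma aux_real (lam : ℝ → ℝ) (K : ℝ) (h0 : ∀ y, 0 ≤ lam y) (hK : ∀ y, lam y ≤ K) :
    ∃ g : ℝ → ℝ, Measurable g ∧ (∀ τ, 0 ≤ g τ ∧ g τ ≤ lam τ) ∧
      (∀ τ, ∃ y : ℕ → ℝ, Tendsto y atTop (nhds τ) ∧ ∀ n, lam (y n) ≤ g τ + 1 / ((n : ℝ) + 1)) ∧
      ((∀ τ, 0 < τ → 0 < g τ) → ∃ h : ℝ → ℝ, Continuous h ∧ (∀ τ, 0 ≤ h τ ∧ h τ ≤ g τ) ∧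
        ∀ k : ℕ, 1 / 2 ≤ ∫ τ in (k : ℝ)..(k + 1), h τ / g τ) := by
  obtain ⟨hh, hc, hm, hb, hy⟩ := aux_inf lam K h0 hK
  have hbdd : ∀ τ, BddAbove (Set.range fun n => hh n τ) := by
    intro τ
    refine ⟨lam τ, ?_⟩
    rintro _ ⟨n, rfl⟩
    exact (hb n τ).2
  set g : ℝ → ℝ := fun τ => ⨆ n, hh n τ with hg
  have hle : ∀ n τ, hh n τ ≤ g τ := fun n τ => le_ciSup (hbdd τ) n
  have hlim : ∀ τ, Tendsto (fun n => hh n τ) atTop (nhds (g τ)) := fun τ =>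
    tendsto_atTop_ciSup (hm τ) (hbdd τ)
  have hgm : Measurable g := measurable_of_tendsto_metrizable (fun n => (hc n).measurable)
    (tendsto_pi_nhds.2 hlim)
  refine ⟨g, hgm, fun τ => ⟨(hb 0 τ).1.trans (hle 0 τ), ciSup_le fun n => (hb n τ).2⟩, ?_, ?_⟩
  · intro τ
    choose y hy1 hy2 using fun n => hy n τ
    refine ⟨y, ?_, fun n => (hy2 n).trans (by linarith [hle n τ])⟩
    rw [tendsto_iff_dist_tendsto_zero]
    refine squeeze_zero (fun _ => dist_nonneg) (g := fun n : ℕ => (K + 1) * (1 / ((n : ℝ) + 1))) ?_ ?_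
    · intro n
      rw [Real.dist_eq, abs_sub_comm]
      simpa [div_eq_mul_inv] using hy1 n
    · simpa using (tendsto_one_div_add_atTop_nhds_zero_nat (𝕜 := ℝ)).const_mul (K + 1)
  · intro hpos
    have hsel : ∀ k : ℕ, ∃ n : ℕ, 1 / 2 ≤ ∫ τ in (k : ℝ)..(k + 1), hh n τ / g τ := by
      intro k
      have ht : Tendsto (fun n : ℕ => ∫ τ in (k : ℝ)..(k + 1), hh n τ / g τ) atTop
          (nhds (∫ τ in (k : ℝ)..(k + 1), (1 : ℝ))) := by
        apply intervalIntegral.tendsto_integral_filter_of_dominated_convergence (fun _ => (1:ℝ))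
        · exact Eventually.of_forall fun n => ((hc n).measurable.div hgm).aestronglyMeasurable
        · refine Eventually.of_forall fun n => Eventually.of_forall fun τ _ => ?_
          have h1 := (hb n τ).1
          rw [Real.norm_of_nonneg (div_nonneg h1 (h1.trans (hle n τ)))]
          exact div_le_one_of_le₀ (hle n τ) (h1.trans (hle n τ))
        · exact intervalIntegrable_const
        · refine Eventually.of_forall fun τ hτ => ?_
          rw [Set.uIoc_of_le (by linarith)] at hτ
          have hp : 0 < g τ := hpos τ (lt_of_le_of_lt (Nat.cast_nonneg k) hτ.1)
          have := (hlim τ).div_const (g τ)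
          rwa [div_self hp.ne'] at this
      have h1 : (∫ τ in (k : ℝ)..(k + 1), (1 : ℝ)) = 1 := by simp
      rw [h1] at ht
      exact (ht.eventually (eventually_ge_nhds (by norm_num : (1/2 : ℝ) < 1))).exists
    choose n hn using hsel
    set N : ℕ → ℕ := fun k => (Finset.range (k + 1)).sup n with hN
    have hNm : Monotone N := fun a b hab => Finset.sup_mono (by
      intro x; simp only [Finset.mem_range]; omega)
    have hnN : ∀ k, n k ≤ N k := fun k => Finset.le_sup (f := n) (by simp)
    obtain ⟨h, hsp⟩ := exists_continuous_forall_mem_convex_of_local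
      (t := fun τ : ℝ => Set.Icc (hh (N ⌊τ⌋₊) τ) (g τ)) (fun τ => convex_Icc _ _) (by
        intro τ
        refine ⟨Set.Iio (τ + 1), Iio_mem_nhds (by linarith), hh (N ⌊τ+1⌋₊), (hc _).continuousOn, ?_⟩
        intro y hy
        exact ⟨hm y (hNm (Nat.floor_mono (le_of_lt hy))), hle _ _⟩)
    have hpt : ∀ τ, 0 ≤ h τ := fun τ => (hb _ τ).1.trans (hsp τ).1
    refine ⟨h, h.continuous, fun τ => ⟨hpt τ, (hsp τ).2⟩, fun k => (hn k).trans ?_⟩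
    have hii : ∀ f : ℝ → ℝ, Continuous f → (∀ τ, 0 ≤ f τ ∧ f τ ≤ g τ) →
        IntervalIntegrable (fun τ => f τ / g τ) volume (k : ℝ) (k + 1) := by
      intro f hf hfb
      refine (intervalIntegrable_const (c := (1:ℝ))).mono_fun
        (hf.measurable.div hgm).aestronglyMeasurable (Eventually.of_forall fun τ => ?_)
      have h1 := (hfb τ).1
      have h2 := (hfb τ).2
      beta_reduce
      rw [Real.norm_of_nonneg (div_nonneg h1 (h1.trans h2)), norm_one]
      exact div_le_one_of_le₀ h2 (h1.trans h2)
    apply intervalIntegral.integral_mono_on_of_le_Ioo (by linarith)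
      (hii _ (hc _) (fun τ => ⟨(hb _ τ).1, hle _ τ⟩))
      (hii _ h.continuous (fun τ => ⟨hpt τ, (hsp τ).2⟩))
    intro τ hτ
    have hfl : ⌊τ⌋₊ = k := by
      rw [Nat.floor_eq_iff ((Nat.cast_nonneg k).trans hτ.1.le)]
      exact ⟨hτ.1.le, hτ.2⟩
    have h3 := (hsp τ).1
    rw [hfl] at h3
    have : 0 ≤ g τ := (hpt τ).trans (hsp τ).2
    have := (hm τ (hnN k)).trans h3
    gcongr

/-- core computation -/
lemma aux_core (p K A B w0 k : ℝ) (g h w f : ℝ → ℝ) (hp : 1 ≤ p) (hK : 0 ≤ K)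
    (hA : 0 ≤ A) (hB : 0 ≤ B) (hw0 : 0 < w0)
    (hgK : ∀ τ ∈ Set.Ioo k (k + 1), g τ ≤ K)
    (hgpos : ∀ τ ∈ Set.Ioo k (k + 1), 0 < g τ)
    (hh : ∀ τ, 0 ≤ h τ) (hf : ∀ τ, 0 ≤ f τ)
    (hw : ∀ τ ∈ Set.Ioo k (k + 1), w0 ≤ w τ)
    (hAB : ∀ τ ∈ Set.Ioo k (k + 1), A ≤ B * g τ * f τ)
    (hint : 1 / 2 ≤ ∫ τ in k..(k + 1), h τ / g τ)
    (hF : IntervalIntegrable (fun τ => h τ * w τ ^ p * f τ ^ p) volume k (k + 1)) :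
    A ^ p ≤ 2 * (B / w0) ^ p * K ^ (p - 1) * ∫ τ in k..(k + 1), h τ * w τ ^ p * f τ ^ p := by
  have hp0 : 0 < p := by linarith
  have hi : IntervalIntegrable (fun τ => h τ / g τ) volume k (k + 1) := by
    by_contra hcon
    rw [intervalIntegral.integral_undef hcon] at hint
    norm_num at hint
  have key : ∀ τ ∈ Set.Ioo k (k + 1), A ^ p * (h τ / g τ) ≤
      (B / w0) ^ p * K ^ (p - 1) * (h τ * w τ ^ p * f τ ^ p) := by
    intro τ hτ
    have hgp := hgpos τ hτ
    have h1 : A ^ p ≤ (B * g τ * f τ) ^ p := Real.rpow_le_rpow hA (hAB τ hτ) hp0.le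
    have hfτ := hf τ
    have hhτ := hh τ
    rw [Real.mul_rpow (by positivity) hfτ, Real.mul_rpow hB hgp.le] at h1
    have h2 : g τ ^ p ≤ g τ * K ^ (p - 1) := by
      have : g τ ^ p = g τ * g τ ^ (p - 1) := by
        rw [← Real.rpow_one_add' hgp.le (by linarith)]; congr 1; ring
      rw [this]
      have := Real.rpow_le_rpow hgp.le (hgK τ hτ) (by linarith : 0 ≤ p - 1)
      gcongr
    have h3 : w0 ^ p ≤ w τ ^ p := Real.rpow_le_rpow hw0.le (hw τ hτ) hp0.le
    have hw0p : 0 < w0 ^ p := Real.rpow_pos_of_pos hw0 p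
    calc A ^ p * (h τ / g τ) ≤ (B ^ p * (g τ * K ^ (p - 1)) * f τ ^ p) * (h τ / g τ) := by
          gcongr
          exact h1.trans (by gcongr)
      _ = (B ^ p / w0 ^ p) * K ^ (p - 1) * (h τ * w0 ^ p * f τ ^ p) := by
          field_simp
      _ ≤ (B ^ p / w0 ^ p) * K ^ (p - 1) * (h τ * w τ ^ p * f τ ^ p) := by
          gcongr
      _ = _ := by rw [Real.div_rpow hB hw0.le]
  have h4 := intervalIntegral.integral_mono_on_of_le_Ioo (by linarith) (hi.const_mul (A ^ p))
    (hF.const_mul ((B / w0) ^ p * K ^ (p - 1))) key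
  rw [intervalIntegral.integral_const_mul, intervalIntegral.integral_const_mul] at h4
  have : 0 ≤ A ^ p := by positivity
  nlinarith [mul_le_mul_of_nonneg_left hint this]

/-- root extraction -/
lemma aux_root (p K D A C E I : ℝ) (hp : 1 ≤ p) (hK : 1 ≤ K) (hD : 0 < D)
    (hA : 0 ≤ A) (hC : 0 ≤ C) (hE : 0 ≤ E)
    (h1 : A ^ p ≤ 2 * C ^ p * K ^ (p - 1) * I) (h2 : I ≤ 2 ^ (p - 1) * D * E ^ p) :
    A ≤ 2 * C * K * max D 1 * E := by
  have hp0 : 0 < p := by linarith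
  have hD1 : (1:ℝ) ≤ max D 1 := le_max_right _ _
  rw [← Real.rpow_le_rpow_iff hA (by positivity) hp0]
  rw [Real.mul_rpow (by positivity) hE, Real.mul_rpow (by positivity) (by positivity),
    Real.mul_rpow (by positivity) (by positivity), Real.mul_rpow (by positivity) (by positivity)]
  have hK1 : K ^ (p - 1) ≤ K ^ p := Real.rpow_le_rpow_of_exponent_le hK (by linarith)
  have hD2 : D ≤ max D 1 ^ p := (le_max_left D 1).trans (by
    simpa using Real.rpow_le_rpow_of_exponent_le hD1 hp)
  have h2p : (2:ℝ) ^ p = 2 * 2 ^ (p - 1) := by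
    rw [← Real.rpow_one_add' (by norm_num) (by linarith)]; congr 1; ring
  calc A ^ p ≤ 2 * C ^ p * K ^ (p - 1) * I := h1
    _ ≤ 2 * C ^ p * K ^ (p - 1) * (2 ^ (p - 1) * D * E ^ p) := by gcongr
    _ ≤ 2 * C ^ p * K ^ p * (2 ^ (p - 1) * max D 1 ^ p * E ^ p) := by gcongr
    _ = _ := by rw [h2p]; ring

lemma aux_deriv_nonneg {μ : ℝ → ℝ} (hgr : IsGrowthRate μ)
    (hdiff : ∀ t, 0 ≤ t → DifferentiableAt ℝ μ t) (t : ℝ) (ht : 0 ≤ t) : 0 ≤ deriv μ t := by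
  rw [← (hdiff t ht).derivWithin (uniqueDiffOn_Ici 0 t ht)]
  exact hgr.2.1.derivWithin_nonneg

lemma aux_ratio {μ : ℝ → ℝ} {K : ℝ} (hgr : IsGrowthRate μ)
    (hdiff : ∀ t, 0 ≤ t → DifferentiableAt ℝ μ t)
    (hK : ∀ t, 0 ≤ t → deriv μ t / μ t ≤ K) (s t : ℝ) (hs : 0 ≤ s) (hst : s ≤ t) :
    μ t ≤ Real.exp (K * (t - s)) * μ s := by
  have hpos : ∀ t, 0 ≤ t → 0 < μ t := fun t ht => lt_of_lt_of_le one_pos (hgr.1 t ht)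
  have hd : ∀ t, 0 ≤ t → HasDerivAt (fun t => Real.log (μ t)) (deriv μ t / μ t) t := fun t ht =>
    (hdiff t ht).hasDerivAt.log (hpos t ht).ne'
  have h := Convex.image_sub_le_mul_sub_of_deriv_le (convex_Ici (0:ℝ))
    (f := fun t => Real.log (μ t)) (C := K)
    (fun t ht => (hd t ht).continuousAt.continuousWithinAt)
    (fun t ht => (hd t (interior_subset ht)).differentiableAt.differentiableWithinAt)
    (fun t ht => by rw [(hd t (interior_subset ht)).deriv]; exact hK t (interior_subset ht))
    s hs t (hs.trans hst) hst
  beta_reduce at h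
  have h1 : Real.log (μ t) ≤ K * (t - s) + Real.log (μ s) := by linarith
  calc μ t = Real.exp (Real.log (μ t)) := (Real.exp_log (hpos t (hs.trans hst))).symm
    _ ≤ Real.exp (K * (t - s) + Real.log (μ s)) := Real.exp_le_exp.2 h1
    _ = _ := by rw [Real.exp_add, Real.exp_log (hpos s hs)]

lemma aux_cocycle {U V : ℝ → ℝ → X →L[ℝ] X} {P : ℝ → X →L[ℝ] X}
    (hU : IsEvolutionOperator U) (hC : CompatibleProjection U V P)
    (s r t : ℝ) (hs : 0 ≤ s) (hsr : s ≤ r) (hrt : r ≤ t) (x : X) :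
    V s t ((1 - P t) (U t r x)) = V s r ((1 - P r) x) := by
  have h1 : (1 - P t) (U t r x) = U t r ((1 - P r) x) := by
    have := DFunLike.congr_fun (hC.1 r t (hs.trans hsr) hrt) x
    simp only [ContinuousLinearMap.comp_apply] at this
    simp [this]
  have h2 : U t r ((1 - P r) x) = U t s (V s r ((1 - P r) x)) := by
    rw [← hC.2.2.1 s r hs hsr x]
    have := DFunLike.congr_fun (hU.2.1 s r t hs hsr hrt) (V s r ((1 - P r) x))
    simp only [ContinuousLinearMap.comp_apply] at this
    rw [this, hC.2.2.1 s r hs hsr x]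
  rw [h1, h2, ← hC.2.1 s r hs hsr x, hC.2.2.2 s t hs (hsr.trans hrt)]

section green
variable {U V : ℝ → ℝ → X →L[ℝ] X} {P : ℝ → X →L[ℝ] X} {μ lam g : ℝ → ℝ} {M ω α : ℝ}

lemma aux_seq {t c : ℝ} (ht : 0 ≤ t) (y : ℕ → ℝ) (hy : Tendsto y atTop (nhds t))
    (hμ : ContinuousAt μ t) :
    Tendsto (fun n => |y n|) atTop (nhds t) ∧ Tendsto (fun n => μ |y n|) atTop (nhds (μ t)) ∧
    Tendsto (fun n : ℕ => c + 1 / ((n : ℝ) + 1)) atTop (nhds c) := by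
  have h1 : Tendsto (fun n => |y n|) atTop (nhds t) := by
    simpa [abs_of_nonneg ht] using hy.abs
  refine ⟨h1, hμ.tendsto.comp h1, ?_⟩
  simpa using (tendsto_one_div_add_atTop_nhds_zero_nat (𝕜 := ℝ)).const_add c

lemma aux_contU (hU : IsEvolutionOperator U) {s t : ℝ} (hs : 0 ≤ s) (hst : s < t)
    (y : ℕ → ℝ) (hy0 : ∀ n, 0 ≤ y n) (hy : Tendsto y atTop (nhds s)) (x : X) :
    Tendsto (fun n => U t (y n) x) atTop (nhds (U t s x)) := by
  have h := hU.2.2 x (t, s) ⟨hs, hst.le⟩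
  have h2 : Tendsto (fun n => (t, y n)) atTop
      (nhdsWithin (t, s) {q : ℝ × ℝ | 0 ≤ q.2 ∧ q.2 ≤ q.1}) := by
    refine tendsto_nhdsWithin_iff.2 ⟨tendsto_const_nhds.prodMk_nhds hy, ?_⟩
    filter_upwards [hy.eventually (eventually_lt_nhds hst)] with n hn
    exact ⟨hy0 n, hn.le⟩
  exact h.tendsto.comp h2

lemma aux_greenP (hU : IsEvolutionOperator U) (hC : CompatibleProjection U V P)
    (hμ1 : ∀ t, 0 ≤ t → 1 ≤ μ t) (hμc : ∀ t, 0 ≤ t → ContinuousAt μ t) (hM : 0 ≤ M)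
    (hl : ∀ τ, ∃ y : ℕ → ℝ, Tendsto y atTop (nhds τ) ∧ ∀ n, lam (y n) ≤ g τ + 1 / ((n : ℝ) + 1))
    (hG : ∀ s t, 0 ≤ |s| → |s| < t → ∀ x, ‖U t |s| (P |s| x)‖ ≤
      M * lam s * (μ t / μ |s|) ^ ω * μ |s| ^ α * ‖x‖)
    (s t : ℝ) (hs : 0 ≤ s) (hst : s < t) (x : X) :
    ‖U t s (P s x)‖ ≤ M * g s * (μ t / μ s) ^ ω * μ s ^ α * ‖x‖ := by
  have hpos : ∀ t, 0 ≤ t → 0 < μ t := fun t ht => lt_of_lt_of_le one_pos (hμ1 t ht)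
  obtain ⟨y, hy, hyl⟩ := hl s
  obtain ⟨h1, h2, h3⟩ := aux_seq (c := g s) hs y hy (hμc s hs)
  have hcomm : ∀ r, 0 ≤ r → r < t → U t r (P r x) = P t (U t r x) := fun r hr hrt =>
    (DFunLike.congr_fun (hC.1 r t hr hrt.le) x).symm
  rw [hcomm s hs hst]
  have hL : Tendsto (fun n => ‖P t (U t |y n| x)‖) atTop (nhds ‖P t (U t s x)‖) :=
    (((P t).continuous.tendsto _).comp
      (aux_contU hU hs hst (fun n => |y n|) (fun n => abs_nonneg _) h1 x)).norm
  have hR : Tendsto (fun n : ℕ => M * (g s + 1 / ((n : ℝ) + 1)) * (μ t / μ |y n|) ^ ω *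
      μ |y n| ^ α * ‖x‖) atTop (nhds (M * g s * (μ t / μ s) ^ ω * μ s ^ α * ‖x‖)) := by
    have h4 : Tendsto (fun n => μ t / μ |y n|) atTop (nhds (μ t / μ s)) :=
      tendsto_const_nhds.div h2 (hpos s hs).ne'
    have h5 := h4.rpow_const (p := ω) (Or.inl (div_pos (hpos t (hs.trans hst.le)) (hpos s hs)).ne')
    have h6 := h2.rpow_const (p := α) (Or.inl (hpos s hs).ne')
    exact (((h3.const_mul M).mul h5).mul h6).mul_const _
  refine le_of_tendsto_of_tendsto hL hR ?_
  filter_upwards [h1.eventually (eventually_lt_nhds hst)] with n hn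
  rw [← hcomm _ (abs_nonneg _) hn]
  refine (hG (y n) t (abs_nonneg _) hn x).trans ?_
  have := hpos t (hs.trans hst.le)
  have := hpos _ (abs_nonneg (y n))
  have := hyl n
  gcongr

lemma aux_greenQ (hU : IsEvolutionOperator U) (hC : CompatibleProjection U V P)
    (hμ1 : ∀ t, 0 ≤ t → 1 ≤ μ t) (hμc : ∀ t, 0 ≤ t → ContinuousAt μ t) (hM : 0 ≤ M)
    (hl : ∀ τ, ∃ y : ℕ → ℝ, Tendsto y atTop (nhds τ) ∧ ∀ n, lam (y n) ≤ g τ + 1 / ((n : ℝ) + 1))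
    (hG : ∀ s t, 0 ≤ s → s < |t| → ∀ x, ‖V s |t| ((1 - P |t|) x)‖ ≤
      M * lam t * (μ |t| / μ s) ^ ω * μ |t| ^ α * ‖x‖)
    (s t : ℝ) (hs : 0 ≤ s) (hst : s < t) (x : X) :
    ‖V s t ((1 - P t) x)‖ ≤ M * g t * (μ t / μ s) ^ ω * μ t ^ α * ‖x‖ := by
  have hpos : ∀ t, 0 ≤ t → 0 < μ t := fun t ht => lt_of_lt_of_le one_pos (hμ1 t ht)
  have ht : 0 ≤ t := hs.trans hst.le
  obtain ⟨y, hy, hyl⟩ := hl t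
  obtain ⟨h1, h2, h3⟩ := aux_seq (c := g t) ht y hy (hμc t ht)
  rw [← aux_cocycle hU hC s t (t + 1) hs hst.le (by linarith) x]
  have hL : Tendsto (fun n => ‖V s (t + 1) ((1 - P (t + 1)) (U (t + 1) |y n| x))‖) atTop
      (nhds ‖V s (t + 1) ((1 - P (t + 1)) (U (t + 1) t x))‖) :=
    ((((V s (t + 1)).comp (1 - P (t + 1))).continuous.tendsto _).comp
      (aux_contU hU ht (by linarith) (fun n => |y n|) (fun n => abs_nonneg _) h1 x)).norm
  have hR : Tendsto (fun n : ℕ => M * (g t + 1 / ((n : ℝ) + 1)) * (μ |y n| / μ s) ^ ω *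
      μ |y n| ^ α * ‖x‖) atTop (nhds (M * g t * (μ t / μ s) ^ ω * μ t ^ α * ‖x‖)) := by
    have h4 : Tendsto (fun n => μ |y n| / μ s) atTop (nhds (μ t / μ s)) := h2.div_const _
    have h5 := h4.rpow_const (p := ω) (Or.inl (div_pos (hpos t ht) (hpos s hs)).ne')
    have h6 := h2.rpow_const (p := α) (Or.inl (hpos t ht).ne')
    exact (((h3.const_mul M).mul h5).mul h6).mul_const _
  refine le_of_tendsto_of_tendsto hL hR ?_
  filter_upwards [h1.eventually (eventually_gt_nhds hst),
    h1.eventually (eventually_lt_nhds (show t < t + 1 by linarith))] with n hn hn'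
  rw [aux_cocycle hU hC s |y n| (t + 1) hs hn.le hn'.le x]
  refine (hG s (y n) hs hn x).trans ?_
  have := hpos s hs
  have := hpos _ (abs_nonneg (y n))
  have := hyl n
  gcongr

end green

lemma aux_window (p K A B w0 k s t D E : ℝ) (g h w f : ℝ → ℝ) (hp : 1 ≤ p) (hK : 1 ≤ K)
    (hA : 0 ≤ A) (hB : 0 ≤ B) (hw0 : 0 < w0) (hD : 0 < D) (hE : 0 ≤ E)
    (hsk : s ≤ k) (hkt : k + 1 ≤ t)
    (hgK : ∀ τ ∈ Set.Ioo k (k + 1), g τ ≤ K)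
    (hgpos : ∀ τ ∈ Set.Ioo k (k + 1), 0 < g τ)
    (hh : ∀ τ, 0 ≤ h τ) (hf : ∀ τ, 0 ≤ f τ) (hw' : ∀ τ ∈ Set.Icc s t, 0 < w τ)
    (hw : ∀ τ ∈ Set.Ioo k (k + 1), w0 ≤ w τ)
    (hAB : ∀ τ ∈ Set.Ioo k (k + 1), A ≤ B * g τ * f τ)
    (hint : 1 / 2 ≤ ∫ τ in k..(k + 1), h τ / g τ)
    (hhc : ContinuousOn h (Set.Icc s t)) (hwc : ContinuousOn w (Set.Icc s t))
    (hfc : ContinuousOn f (Set.Icc s t))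
    (hI : ∫ τ in s..t, h τ * w τ ^ p * f τ ^ p ≤ 2 ^ (p - 1) * D * E ^ p) :
    A ≤ 2 * (B / w0) * K * max D 1 * E := by
  have hp0 : 0 < p := by linarith
  have hc : ContinuousOn (fun τ => h τ * w τ ^ p * f τ ^ p) (Set.Icc s t) :=
    (hhc.mul (hwc.rpow_const fun _ _ => Or.inr hp0.le)).mul
      (hfc.rpow_const fun _ _ => Or.inr hp0.le)
  have hi : IntervalIntegrable (fun τ => h τ * w τ ^ p * f τ ^ p) volume s t :=
    hc.intervalIntegrable_of_Icc (by linarith)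
  have hi2 : IntervalIntegrable (fun τ => h τ * w τ ^ p * f τ ^ p) volume k (k + 1) :=
    (hc.mono (Set.Icc_subset_Icc hsk hkt)).intervalIntegrable_of_Icc (by linarith)
  refine aux_root p K D A (B / w0) E _ hp hK hD hA (by positivity) hE
    (aux_core p K A B w0 k g h w f hp (by linarith) hA hB hw0 hgK hgpos hh hf hw hAB hint hi2) ?_
  refine le_trans ?_ hI
  apply intervalIntegral.integral_mono_interval hsk (by linarith) hkt _ hi
  filter_upwards [ae_restrict_mem measurableSet_Ioc] with τ hτ
  have h1 := hw' τ ⟨hτ.1.le, hτ.2⟩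
  have h2 := hh τ
  have h3 := hf τ
  positivity

lemma aux_finP (M R ω α γ K D ε a b x : ℝ) (hM : 0 ≤ M) (hR : 1 ≤ R) (hα : 0 ≤ α) (hK : 1 ≤ K)
    (hD : 1 ≤ D) (ha : 1 ≤ a) (hb : 1 ≤ b) (hx : 0 ≤ x) :
    2 * ((M * R ^ ω * a ^ α) / (a / R) ^ γ) * K * D * (b ^ (γ + ε) * x) ≤
      2 * K * D * M * R ^ (ω + α + γ) * (a / b) ^ (-(γ - α)) * b ^ (ε + α) * x := by
  have hR0 : 0 < R := by linarith
  have ha0 : 0 < a := by linarith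
  have hb0 : 0 < b := by linarith
  have hRα : 1 ≤ R ^ α := Real.one_le_rpow hR hα
  rw [Real.div_rpow ha0.le hR0.le, Real.div_rpow ha0.le hb0.le, Real.rpow_add hR0,
    Real.rpow_add hR0, Real.rpow_add hb0, Real.rpow_add hb0, neg_sub, Real.rpow_sub ha0,
    Real.rpow_sub hb0]
  have e1 : 2 * ((M * R ^ ω * a ^ α) / (a ^ γ / R ^ γ)) * K * D * (b ^ γ * b ^ ε * x) =
    2 * K * D * M * (R ^ ω * 1 * R ^ γ) * (a ^ α / a ^ γ) * b ^ γ * b ^ ε * x := by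
    field_simp
  have e2 : 2 * K * D * M * (R ^ ω * R ^ α * R ^ γ) * (a ^ α / a ^ γ / (b ^ α / b ^ γ)) *
    (b ^ ε * b ^ α) * x =
    2 * K * D * M * (R ^ ω * R ^ α * R ^ γ) * (a ^ α / a ^ γ) * b ^ γ * b ^ ε * x := by
    field_simp
  rw [e1, e2]
  gcongr

lemma aux_finQ (M R ω α γ K D ε a b x : ℝ) (hR : 1 ≤ R) (ha : 1 ≤ a) (hb : 1 ≤ b) :
    2 * ((M * R ^ ω * (R * b) ^ α) / (R * b) ^ (-γ)) * K * D * (a ^ (ε - γ) * x) =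
      2 * K * D * M * R ^ (ω + α + γ) * (a / b) ^ (-(γ + α)) * a ^ (ε + α) * x := by
  have hR0 : 0 < R := by linarith
  have ha0 : 0 < a := by linarith
  have hb0 : 0 < b := by linarith
  rw [Real.mul_rpow hR0.le hb0.le, Real.mul_rpow hR0.le hb0.le, Real.div_rpow ha0.le hb0.le,
    Real.rpow_add hR0, Real.rpow_add hR0, Real.rpow_add ha0, Real.rpow_sub ha0,
    Real.rpow_neg ha0.le, Real.rpow_neg hb0.le, Real.rpow_neg hR0.le, Real.rpow_neg hb0.le,
    Real.rpow_add ha0, Real.rpow_add hb0]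
  field_simp

/-- short-time estimate -/
lemma aux_short (M R ω α γ β K D ε a b c : ℝ) (hM : 0 ≤ M) (hR : 1 ≤ R) (hK : 1 ≤ K)
    (hD : 1 ≤ D) (ha : 1 ≤ a) (hb : 1 ≤ b) (hba : b ≤ a) (haR : a ≤ R * b) (hc : 1 ≤ c)
    (hε : 0 ≤ ε) (hω : 0 ≤ ω) (hβ : 0 ≤ β) (hβ' : β ≤ γ + α) :
    2 * M * K * (a / b) ^ ω * c ^ α ≤
      2 * K * D * M * R ^ (ω + α + γ) * (a / b) ^ (-β) * c ^ (ε + α) := by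
  have hb0 : 0 < b := by linarith
  have h0 : 1 ≤ a / b := by rwa [le_div_iff₀ hb0, one_mul]
  have h1 : a / b ≤ R := by rwa [div_le_iff₀ hb0]
  have h2 : (a / b) ^ ω ≤ R ^ (ω + α + γ) * (a / b) ^ (-β) := by
    rw [Real.rpow_neg (by positivity), ← div_eq_mul_inv, le_div_iff₀ (by positivity),
      ← Real.rpow_add (by positivity)]
    calc (a / b) ^ (ω + β) ≤ R ^ (ω + β) := Real.rpow_le_rpow (by positivity) h1 (by linarith)
      _ ≤ _ := Real.rpow_le_rpow_of_exponent_le hR (by linarith)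
  have h3 : c ^ α ≤ c ^ (ε + α) := Real.rpow_le_rpow_of_exponent_le hc (by linarith)
  calc 2 * M * K * (a / b) ^ ω * c ^ α = 2 * K * 1 * M * ((a / b) ^ ω) * c ^ α := by ring
    _ ≤ 2 * K * D * M * (R ^ (ω + α + γ) * (a / b) ^ (-β)) * c ^ (ε + α) := by gcongr
    _ = _ := by ring

/-- Theorem 3.7: let `μ` be a differentiable growth rate with bounded logarithmic
derivative and suppose the Green function satisfies
`‖G(t,s)‖ ≤ M (μ'(s)/μ(s)) (μ(t)/μ(s))^{ω sign(t-s)} μ(s)^α` for `t ≠ s`. If for some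
`p ≥ 1`, `γ > α` and every `H ∈ H^μ_{γ,p}(P)` there exist `ε ≥ 0`, `D > 0` and a
function `L` satisfying conditions (i)–(iii) of Theorem 3.6, then `U` has a nonuniform
μ-dichotomy with projection valued function `P`. -/
theorem lyapunov_function_implies_dichotomy
    {X : Type*} [NormedAddCommGroup X] [NormedSpace ℝ X] [CompleteSpace X]
    (μ : ℝ → ℝ) (Kμ : ℝ) (hgr : IsGrowthRate μ)
    (hdiff : ∀ t, 0 ≤ t → DifferentiableAt ℝ μ t)
    (hKμ : ∀ t, 0 ≤ t → deriv μ t / μ t ≤ Kμ)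
    (U V : ℝ → ℝ → X →L[ℝ] X) (P : ℝ → X →L[ℝ] X)
    (hU : IsEvolutionOperator U) (hP : IsProjectionValued P)
    (hC : CompatibleProjection U V P)
    (M ω α : ℝ) (hω : 0 < ω) (hα : 0 ≤ α) (hM : 1 ≤ M)
    (hG : ∀ t s, 0 ≤ t → 0 ≤ s → t ≠ s →
      ‖greenFunction U V P t s‖ ≤
        M * (deriv μ s / μ s) * (μ t / μ s) ^ (ω * Real.sign (t - s)) * μ s ^ α)
    (p γ : ℝ) (hp : 1 ≤ p) (hγ : α < γ)
    (hyp : ∀ H : ℝ → X →L[ℝ] X, MemHClass μ P γ p H →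
      ∃ (ε D : ℝ) (L : ℝ → X → ℝ), 0 ≤ ε ∧ 0 < D ∧
        (∀ s t, 0 ≤ s → s ≤ t → ∀ x : X,
          L t (U t s x) + ∫ τ in s..t, ‖H τ (U τ s x)‖ ^ p ≤ L s x) ∧
        (∀ t, 0 ≤ t → ∀ x : X, 0 ≤ L t (P t x) ∧ L t ((1 - P t) x) ≤ 0) ∧
        (∀ t, 0 ≤ t → ∀ x : X,
          μ t ^ (-(p * γ)) * L t (P t x) - μ t ^ (p * γ) * L t ((1 - P t) x) ≤
            (2 : ℝ) ^ (p - 1) * D * μ t ^ (p * ε) * ‖x‖ ^ p)) :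
    NonuniformMuDichotomy μ U V P := by
  rcases subsingleton_or_nontrivial X with hX | hX
  · refine ⟨1, 1, 0, 1, 1, one_pos, one_pos, le_refl _, le_refl _, le_refl _, ?_⟩
    intro s t hs hst
    have h1 : 0 < μ s := lt_of_lt_of_le one_pos (hgr.1 s hs)
    have h2 : 0 < μ t := lt_of_lt_of_le one_pos (hgr.1 t (hs.trans hst))
    rw [Subsingleton.elim ((U t s).comp (P s)) 0, Subsingleton.elim ((V s t).comp (1 - P t)) 0,
      norm_zero]
    constructor <;> positivity
  have hpos : ∀ t, 0 ≤ t → 0 < μ t := fun t ht => lt_of_lt_of_le one_pos (hgr.1 t ht)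
  have hμc : ∀ t, 0 ≤ t → ContinuousAt μ t := fun t ht => (hdiff t ht).continuousAt
  have hmono : ∀ s t, 0 ≤ s → s ≤ t → μ s ≤ μ t := fun s t hs hst =>
    hgr.2.1 hs (hs.trans hst) hst
  have hM0 : 0 ≤ M := by linarith
  have hp0 : 0 < p := by linarith
  obtain ⟨K, hK1, hKK⟩ : ∃ K : ℝ, 1 ≤ K ∧ ∀ t, 0 ≤ t → deriv μ t / μ t ≤ K :=
    ⟨max Kμ 1, le_max_right _ _, fun t ht => (hKμ t ht).trans (le_max_left _ _)⟩
  obtain ⟨g, hgm, hgb, hgl, hgh⟩ := aux_real (fun y => deriv μ |y| / μ |y|) K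
    (fun y => div_nonneg (aux_deriv_nonneg hgr hdiff _ (abs_nonneg y)) (hpos _ (abs_nonneg y)).le)
    (fun y => hKK _ (abs_nonneg y))
  have hgK : ∀ τ, g τ ≤ K := fun τ => (hgb τ).2.trans (hKK _ (abs_nonneg τ))
  have hGP : ∀ s t, 0 ≤ s → s < t → ∀ x, ‖U t s (P s x)‖ ≤
      M * g s * (μ t / μ s) ^ ω * μ s ^ α * ‖x‖ := by
    refine aux_greenP (lam := fun y => deriv μ |y| / μ |y|) hU hC hgr.1 hμc hM0 hgl ?_
    intro s t hs hst x
    have h := hG t |s| (hs.trans hst.le) hs hst.ne'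
    rw [Real.sign_of_pos (by linarith), mul_one] at h
    unfold greenFunction at h
    rw [if_pos hst] at h
    exact (((U t |s|).comp (P |s|)).le_opNorm x).trans (by gcongr)
  have hGQ : ∀ s t, 0 ≤ s → s < t → ∀ x, ‖V s t ((1 - P t) x)‖ ≤
      M * g t * (μ t / μ s) ^ ω * μ t ^ α * ‖x‖ := by
    refine aux_greenQ (lam := fun y => deriv μ |y| / μ |y|) hU hC hgr.1 hμc hM0 hgl ?_
    intro s t hs hst x
    have h := hG s |t| hs (abs_nonneg t) hst.ne
    have e : (μ s / μ |t|) ^ (ω * -1) = (μ |t| / μ s) ^ ω := by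
      rw [mul_neg_one, Real.rpow_neg (div_pos (hpos _ hs) (hpos _ (abs_nonneg t))).le,
        ← Real.inv_rpow (div_pos (hpos _ hs) (hpos _ (abs_nonneg t))).le, inv_div]
    rw [Real.sign_of_neg (by linarith), e] at h
    unfold greenFunction at h
    rw [if_neg hst.not_gt, if_pos hst, norm_neg] at h
    exact (((V s |t|).comp (1 - P |t|)).le_opNorm x).trans (by gcongr)
  have hUc : ∀ s, 0 ≤ s → ∀ x, ContinuousOn (fun τ => U τ s x) (Set.Ici s) := by
    intro s hs x
    exact (hU.2.2 x).comp (f := fun τ => (τ, s)) (by fun_prop) (fun τ hτ => ⟨hs, hτ⟩)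
  have hUlim : ∀ s, 0 ≤ s → ∀ x, Tendsto (fun n : ℕ => U (s + 1 / ((n : ℝ) + 1)) s x) atTop
      (nhds x) := by
    intro s hs x
    have h1 := (hUc s hs x s (Set.self_mem_Ici)).tendsto
    beta_reduce at h1
    rw [hU.1 s hs] at h1
    refine h1.comp (tendsto_nhdsWithin_iff.2 ⟨?_, Eventually.of_forall fun n => ?_⟩)
    · simpa using (tendsto_one_div_add_atTop_nhds_zero_nat (𝕜 := ℝ)).const_add s
    · have : 0 < 1 / ((n : ℝ) + 1) := by positivity
      simp only [Set.mem_Ici]; linarith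
  -- positivity of g
  have hgpos : ∀ τ, 0 < τ → 0 < g τ := by
    intro τ hτ
    by_contra hcon
    have hz : g τ = 0 := le_antisymm (not_lt.1 hcon) (hgb τ).1
    obtain ⟨x, hx⟩ := exists_ne (0 : X)
    have hQ : (1 - P τ) x = 0 := by
      have h1 := hGQ 0 τ le_rfl hτ x
      rw [hz] at h1
      have h2 : V 0 τ ((1 - P τ) x) = 0 := by
        rw [← norm_le_zero_iff]; simpa using h1
      rw [← hC.2.2.1 0 τ le_rfl hτ.le x, h2, map_zero]
    have hPx : P τ x = 0 := by
      refine tendsto_nhds_unique (hUlim τ hτ.le (P τ x)) ?_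
      have : ∀ n : ℕ, U (τ + 1 / ((n : ℝ) + 1)) τ (P τ x) = 0 := by
        intro n
        have : 0 < 1 / ((n : ℝ) + 1) := by positivity
        have h1 := hGP τ (τ + 1 / ((n : ℝ) + 1)) hτ.le (by linarith) x
        rw [hz] at h1
        rw [← norm_le_zero_iff]; simpa using h1
      simp only [this]
      exact tendsto_const_nhds
    apply hx
    have : x = P τ x + (1 - P τ) x := by simp
    rw [this, hQ, hPx, add_zero]
  obtain ⟨h, hhc, hhb, hhi⟩ := hgh hgpos
  -- the operator H
  set H : ℝ → X →L[ℝ] X := fun τ =>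
    (h τ ^ (1 / p)) • (μ τ ^ γ • P τ + μ τ ^ (-γ) • (1 - P τ)) with hH
  have hμr : ∀ c : ℝ, ContinuousOn (fun τ => μ τ ^ c) (Set.Ici 0) := fun c =>
    ContinuousOn.rpow_const (fun t ht => (hμc t ht).continuousWithinAt)
      (fun t ht => Or.inl (hpos t ht).ne')
  have hHmem : MemHClass μ P γ p H := by
    constructor
    · intro x
      have hPc := hP.2 x
      have hQc : ContinuousOn (fun t => (1 - P t) x) (Set.Ici 0) := by
        exact continuousOn_const.sub hPc
      exact ((hhc.continuousOn.rpow_const fun _ _ => Or.inr (by positivity)).smul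
        (((hμr γ).smul hPc).add ((hμr (-γ)).smul hQc)))
    · intro t ht x
      have h1 : h t ^ (1 / p) ≤ (deriv μ t / μ t) ^ (1 / p) := by
        refine Real.rpow_le_rpow (hhb t).1 ?_ (by positivity)
        have := (hhb t).2.trans (hgb t).2
        rwa [abs_of_nonneg ht] at this
      have h0 : 0 ≤ h t ^ (1 / p) := Real.rpow_nonneg (hhb t).1 _
      have hm := hpos t ht
      have e : H t x = h t ^ (1 / p) • (μ t ^ γ • P t x + μ t ^ (-γ) • (1 - P t) x) := rfl
      rw [e, norm_smul, Real.norm_of_nonneg h0]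
      calc h t ^ (1 / p) * ‖μ t ^ γ • P t x + μ t ^ (-γ) • (1 - P t) x‖
          ≤ h t ^ (1 / p) * (μ t ^ γ * ‖P t x‖ + μ t ^ (-γ) * ‖(1 - P t) x‖) := by
            gcongr
            refine (norm_add_le _ _).trans ?_
            rw [norm_smul, norm_smul, Real.norm_of_nonneg (by positivity),
              Real.norm_of_nonneg (by positivity)]
        _ ≤ (deriv μ t / μ t) ^ (1 / p) * (μ t ^ γ * ‖P t x‖ + μ t ^ (-γ) * ‖(1 - P t) x‖) := by
            gcongr
        _ = _ := by ring
  have hroot : ∀ τ, (h τ ^ (1 / p)) ^ p = h τ := fun τ => by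
    rw [← Real.rpow_mul (hhb τ).1, one_div_mul_cancel hp0.ne', Real.rpow_one]
  have hHP : ∀ τ, 0 ≤ τ → ∀ y, P τ y = y → ‖H τ y‖ ^ p = h τ * (μ τ ^ γ) ^ p * ‖y‖ ^ p := by
    intro τ hτ y hy
    have hm := hpos τ hτ
    have h0 : 0 ≤ h τ ^ (1 / p) := Real.rpow_nonneg (hhb τ).1 _
    have e : H τ y = h τ ^ (1 / p) • (μ τ ^ γ • P τ y + μ τ ^ (-γ) • (y - P τ y)) := rfl
    rw [e, hy, sub_self, smul_zero, add_zero, norm_smul, norm_smul, Real.norm_of_nonneg h0,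
      Real.norm_of_nonneg (by positivity), Real.mul_rpow h0 (by positivity),
      Real.mul_rpow (by positivity) (by positivity), hroot, mul_assoc]
  have hHQ : ∀ τ, 0 ≤ τ → ∀ y, P τ y = 0 → ‖H τ y‖ ^ p = h τ * (μ τ ^ (-γ)) ^ p * ‖y‖ ^ p := by
    intro τ hτ y hy
    have hm := hpos τ hτ
    have h0 : 0 ≤ h τ ^ (1 / p) := Real.rpow_nonneg (hhb τ).1 _
    have e : H τ y = h τ ^ (1 / p) • (μ τ ^ γ • P τ y + μ τ ^ (-γ) • (y - P τ y)) := rfl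
    rw [e, hy, sub_zero, smul_zero, zero_add, norm_smul, norm_smul, Real.norm_of_nonneg h0,
      Real.norm_of_nonneg (by positivity), Real.mul_rpow h0 (by positivity),
      Real.mul_rpow (by positivity) (by positivity), hroot, mul_assoc]
  obtain ⟨ε, D, L, hε, hD, hL1, hL2, hL3⟩ := hyp H hHmem
  set R : ℝ := Real.exp (K * 2) with hR
  have hR1 : 1 ≤ R := Real.one_le_exp (by linarith)
  have hratio : ∀ s t, 0 ≤ s → s ≤ t → t ≤ s + 2 → μ t ≤ R * μ s := by
    intro s t hs hst hts
    refine (aux_ratio hgr hdiff hKK s t hs hst).trans ?_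
    have := (hpos s hs).le
    have h1 : K * (t - s) ≤ K * 2 := by
      have : t - s ≤ 2 := by linarith
      gcongr
    have h2 := Real.exp_le_exp.2 h1
    gcongr
  have hD1 : (1:ℝ) ≤ max D 1 := le_max_right _ _
  have hUU : ∀ s τ t, 0 ≤ s → s ≤ τ → τ ≤ t → ∀ x, U t τ (U τ s x) = U t s x :=
    fun s τ t hs h1 h2 x => DFunLike.congr_fun (hU.2.1 s τ t hs h1 h2) x
  have hPU : ∀ s t, 0 ≤ s → s ≤ t → ∀ x, P t (U t s x) = U t s (P s x) :=
    fun s t hs h1 x => DFunLike.congr_fun (hC.1 s t hs h1) x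
  have hPP : ∀ t, 0 ≤ t → ∀ x, P t (P t x) = P t x :=
    fun t ht x => DFunLike.congr_fun (hP.1 t ht) x
  -- short-time bounds
  have hPs : ∀ s, 0 ≤ s → ∀ x, ‖P s x‖ ≤ M * K * μ s ^ α * ‖x‖ := by
    intro s hs x
    have hl := (hUlim s hs (P s x)).norm
    have hn : Tendsto (fun n : ℕ => s + 1 / ((n : ℝ) + 1)) atTop (nhds s) := by
      simpa using (tendsto_one_div_add_atTop_nhds_zero_nat (𝕜 := ℝ)).const_add s
    have hr : Tendsto (fun n : ℕ => M * K * (μ (s + 1 / ((n : ℝ) + 1)) / μ s) ^ ω * μ s ^ α * ‖x‖)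
        atTop (nhds (M * K * (μ s / μ s) ^ ω * μ s ^ α * ‖x‖)) := by
      have h4 := ((hμc s hs).tendsto.comp hn).div_const (μ s)
      have h5 := h4.rpow_const (p := ω) (Or.inl (div_pos (hpos s hs) (hpos s hs)).ne')
      exact ((h5.const_mul (M * K)).mul_const _).mul_const _
    rw [div_self (hpos s hs).ne', Real.one_rpow, mul_one] at hr
    refine le_of_tendsto_of_tendsto' hl hr fun n => ?_
    have hn0 : 0 < 1 / ((n : ℝ) + 1) := by positivity
    refine (hGP s (s + 1 / ((n : ℝ) + 1)) hs (by linarith) x).trans ?_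
    have := hgK s
    have := hpos s hs
    have := hpos (s + 1 / ((n : ℝ) + 1)) (by linarith)
    gcongr
  have hsP : ∀ s t, 0 ≤ s → s ≤ t → ∀ x, ‖U t s (P s x)‖ ≤
      2 * M * K * (μ t / μ s) ^ ω * μ s ^ α * ‖x‖ := by
    intro s t hs hst x
    have hm := hpos s hs
    have hm' := hpos t (hs.trans hst)
    have hMK : M * K ≤ 2 * M * K := by nlinarith
    rcases hst.eq_or_lt with rfl | hlt
    · rw [hU.1 s hs, div_self hm.ne', Real.one_rpow, mul_one]
      refine (hPs s hs x).trans ?_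
      gcongr
    · refine (hGP s t hs hlt x).trans ?_
      have : M * g s ≤ 2 * M * K := (mul_le_mul_of_nonneg_left (hgK s) hM0).trans hMK
      gcongr
  have hsQ : ∀ s t, 0 ≤ s → s ≤ t → ∀ x, ‖V s t ((1 - P t) x)‖ ≤
      2 * M * K * (μ t / μ s) ^ ω * μ t ^ α * ‖x‖ := by
    intro s t hs hst x
    have hm := hpos s hs
    have hm' := hpos t (hs.trans hst)
    have hMK : M * K ≤ 2 * M * K := by nlinarith
    rcases hst.eq_or_lt with rfl | hlt
    · have e : V s s ((1 - P s) x) = (1 - P s) x := by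
        have := hC.2.2.2 s s hs le_rfl x
        rwa [hU.1 s hs] at this
      rw [e, div_self hm.ne', Real.one_rpow, mul_one]
      have h1 : ‖(1 - P s) x‖ ≤ ‖x‖ + ‖P s x‖ := norm_sub_le _ _
      have h2 := hPs s hs x
      have h3 : 1 ≤ M * K * μ s ^ α := by
        have := Real.one_le_rpow (hgr.1 s hs) hα
        exact one_le_mul_of_one_le_of_one_le (one_le_mul_of_one_le_of_one_le hM hK1) this
      nlinarith [norm_nonneg x]
    · refine (hGQ s t hs hlt x).trans ?_
      have : M * g t ≤ 2 * M * K := (mul_le_mul_of_nonneg_left (hgK t) hM0).trans hMK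
      gcongr
  -- conclusion
  have hN1 : 1 ≤ 2 * K * max D 1 * M * R ^ (ω + α + γ) := by
    have h1 : 1 ≤ R ^ (ω + α + γ) := Real.one_le_rpow hR1 (by linarith)
    refine one_le_mul_of_one_le_of_one_le (one_le_mul_of_one_le_of_one_le
      (one_le_mul_of_one_le_of_one_le (by linarith) hD1) hM) h1
  refine ⟨γ - α, γ + α, ε + α, 2 * K * max D 1 * M * R ^ (ω + α + γ),
    2 * K * max D 1 * M * R ^ (ω + α + γ), by linarith, by linarith, by linarith, hN1, hN1, ?_⟩
  intro s t hs hst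
  have ht : 0 ≤ t := hs.trans hst
  have hms := hpos s hs
  have hmt := hpos t ht
  constructor
  · refine ContinuousLinearMap.opNorm_le_bound _ (by positivity) fun x => ?_
    rw [ContinuousLinearMap.comp_apply]
    rcases le_total t (s + 2) with hshort | hlong
    · refine (hsP s t hs hst x).trans ?_
      have := aux_short M R ω α γ (γ - α) K (max D 1) ε (μ t) (μ s) (μ s) hM0 hR1 hK1 hD1
        (hgr.1 t ht) (hgr.1 s hs) (hmono s t hs hst) (hratio s t hs hst hshort) (hgr.1 s hs)
        hε hω.le (by linarith) (by linarith)
      exact mul_le_mul_of_nonneg_right this (norm_nonneg x)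
    · obtain ⟨k, hk⟩ : ∃ k : ℕ, ⌊t⌋₊ = k + 1 := by
        refine ⟨⌊t⌋₊ - 1, ?_⟩
        have : 1 ≤ ⌊t⌋₊ := Nat.le_floor (by push_cast; linarith)
        omega
      have hk1 : (k : ℝ) + 1 ≤ t := by
        have := Nat.floor_le ht
        rw [hk] at this; exact_mod_cast this
      have hk2 : t < (k : ℝ) + 1 + 1 := by
        have := Nat.lt_floor_add_one t
        rw [hk] at this; exact_mod_cast this
      have hk0 : (0:ℝ) ≤ k := Nat.cast_nonneg k
      refine le_trans ?_ (aux_finP M R ω α γ K (max D 1) ε (μ t) (μ s) ‖x‖ hM0 hR1 hα hK1 hD1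
        (hgr.1 t ht) (hgr.1 s hs) (norm_nonneg x))
      refine aux_window p K _ _ _ k s t D _ g h (fun τ => μ τ ^ γ) (fun τ => ‖U τ s (P s x)‖)
        hp hK1 (norm_nonneg _) (by positivity) (by positivity) hD (by positivity) (by linarith) hk1
        (fun τ _ => hgK τ) (fun τ hτ => hgpos τ (lt_of_le_of_lt hk0 hτ.1)) (fun τ => (hhb τ).1)
        (fun τ => norm_nonneg _)
        (fun τ hτ => Real.rpow_pos_of_pos (hpos τ (hs.trans hτ.1)) _) ?_ ?_ (hhi k)
        hhc.continuousOn ((hμr γ).mono fun τ hτ => hs.trans hτ.1)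
        ((hUc s hs _).mono fun τ hτ => hτ.1).norm ?_
      · intro τ hτ
        have hτ0 : 0 ≤ τ := hk0.trans hτ.1.le
        refine Real.rpow_le_rpow (by positivity) ?_ (by linarith)
        rw [div_le_iff₀ (by linarith), mul_comm]
        exact hratio τ t hτ0 (by linarith [hτ.2]) (by linarith [hτ.1])
      · intro τ hτ
        have hτ0 : 0 ≤ τ := hk0.trans hτ.1.le
        have hsτ : s ≤ τ := by linarith [hτ.1]
        have hτt : τ < t := by linarith [hτ.2]
        have hmτ := hpos τ hτ0
        have e : U t s (P s x) = U t τ (P τ (U τ s (P s x))) := by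
          rw [hPU s τ hs hsτ, hPP s hs, hUU s τ t hs hsτ hτt.le]
        rw [e]
        refine (hGP τ t hτ0 hτt _).trans ?_
        have h1 : (μ t / μ τ) ^ ω ≤ R ^ ω := by
          refine Real.rpow_le_rpow (by positivity) ?_ hω.le
          rw [div_le_iff₀ hmτ]
          exact hratio τ t hτ0 hτt.le (by linarith [hτ.1])
        have h2 : μ τ ^ α ≤ μ t ^ α := Real.rpow_le_rpow hmτ.le (hmono τ t hτ0 hτt.le) hα
        have h3 := (hgb τ).1
        calc M * g τ * (μ t / μ τ) ^ ω * μ τ ^ α * ‖U τ s (P s x)‖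
            ≤ M * g τ * R ^ ω * μ t ^ α * ‖U τ s (P s x)‖ := by gcongr
          _ = _ := by ring
      · have h1 := hL1 s t hs hst (P s x)
        have h2 : (∫ τ in s..t, ‖H τ (U τ s (P s x))‖ ^ p) =
            ∫ τ in s..t, h τ * (μ τ ^ γ) ^ p * ‖U τ s (P s x)‖ ^ p := by
          refine intervalIntegral.integral_congr fun τ hτ => ?_
          rw [Set.uIcc_of_le hst] at hτ
          exact hHP τ (hs.trans hτ.1) _ (by rw [hPU s τ hs hτ.1, hPP s hs])
        rw [h2] at h1
        have h3 : 0 ≤ L t (U t s (P s x)) := by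
          have := (hL2 t ht (U t s x)).1
          rwa [hPU s t hs hst] at this
        have h4 := hL3 s hs x
        have h5 := (hL2 s hs x).2
        have h6 : 0 ≤ μ s ^ (p * γ) * -L s ((1 - P s) x) :=
          mul_nonneg (by positivity) (by linarith)
        have h7 : μ s ^ (-(p * γ)) * L s (P s x) ≤
            (2 : ℝ) ^ (p - 1) * D * μ s ^ (p * ε) * ‖x‖ ^ p := by linarith
        have h8 : L s (P s x) ≤ 2 ^ (p - 1) * D * (μ s ^ (γ + ε) * ‖x‖) ^ p := by
          rw [Real.rpow_neg hms.le, inv_mul_le_iff₀ (by positivity)] at h7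
          refine h7.trans (le_of_eq ?_)
          rw [Real.mul_rpow (by positivity) (norm_nonneg x), ← Real.rpow_mul hms.le,
            add_mul, Real.rpow_add hms, mul_comm p γ, mul_comm p ε]
          ring
        linarith
  · refine ContinuousLinearMap.opNorm_le_bound _ (by positivity) fun x => ?_
    rw [ContinuousLinearMap.comp_apply]
    rcases le_total t (s + 2) with hshort | hlong
    · refine (hsQ s t hs hst x).trans ?_
      have := aux_short M R ω α γ (γ + α) K (max D 1) ε (μ t) (μ s) (μ t) hM0 hR1 hK1 hD1
        (hgr.1 t ht) (hgr.1 s hs) (hmono s t hs hst) (hratio s t hs hst hshort) (hgr.1 t ht)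
        hε hω.le (by linarith) (by linarith)
      exact mul_le_mul_of_nonneg_right this (norm_nonneg x)
    · set k : ℕ := ⌈s⌉₊ with hk
      have hk1 : s ≤ k := Nat.le_ceil s
      have hk2 : (k : ℝ) < s + 1 := Nat.ceil_lt_add_one hs
      have hk0 : (0:ℝ) ≤ k := Nat.cast_nonneg k
      rw [← aux_finQ M R ω α γ K (max D 1) ε (μ t) (μ s) ‖x‖ hR1 (hgr.1 t ht) (hgr.1 s hs)]
      set z : X := V s t ((1 - P t) x) with hz
      have hzQ : (1 - P s) z = z := hC.2.1 s t hs hst x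
      have hPz : P s z = 0 := by
        have : z - P s z = z := hzQ
        simpa using this
      have hUz : U t s z = (1 - P t) x := hC.2.2.1 s t hs hst x
      have hR0 : 0 < R := by linarith
      refine aux_window p K _ _ _ k s t D _ g h (fun τ => μ τ ^ (-γ)) (fun τ => ‖U τ s z‖)
        hp hK1 (norm_nonneg _) (by positivity) (by positivity) hD (by positivity) hk1 (by linarith)
        (fun τ _ => hgK τ) (fun τ hτ => hgpos τ (lt_of_le_of_lt hk0 hτ.1)) (fun τ => (hhb τ).1)
        (fun τ => norm_nonneg _)
        (fun τ hτ => Real.rpow_pos_of_pos (hpos τ (hs.trans hτ.1)) _) ?_ ?_ (hhi k)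
        hhc.continuousOn ((hμr (-γ)).mono fun τ hτ => hs.trans hτ.1)
        ((hUc s hs _).mono fun τ hτ => hτ.1).norm ?_
      · intro τ hτ
        have hτ0 : 0 ≤ τ := hk0.trans hτ.1.le
        exact Real.rpow_le_rpow_of_nonpos (hpos τ hτ0)
          (hratio s τ hs (by linarith [hτ.1]) (by linarith [hτ.2])) (by linarith)
      · intro τ hτ
        have hτ0 : 0 ≤ τ := hk0.trans hτ.1.le
        have hsτ : s < τ := by linarith [hτ.1]
        have hmτ := hpos τ hτ0
        have hrat := hratio s τ hs hsτ.le (by linarith [hτ.2])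
        have e : z = V s τ ((1 - P τ) (U τ s z)) := by
          have h1 : (1 - P τ) (U τ s z) = U τ s z := by
            change U τ s z - P τ (U τ s z) = U τ s z
            rw [hPU s τ hs hsτ.le, hPz, map_zero, sub_zero]
          have h2 := hC.2.2.2 s τ hs hsτ.le z
          rw [hzQ] at h2
          rw [h1, h2]
        have h0 := hGQ s τ hs hsτ (U τ s z)
        rw [← e] at h0
        refine h0.trans ?_
        have h1 : (μ τ / μ s) ^ ω ≤ R ^ ω := by
          refine Real.rpow_le_rpow (by positivity) ?_ hω.le
          rwa [div_le_iff₀ hms]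
        have h2 : μ τ ^ α ≤ (R * μ s) ^ α := Real.rpow_le_rpow hmτ.le hrat hα
        have h3 := (hgb τ).1
        calc M * g τ * (μ τ / μ s) ^ ω * μ τ ^ α * ‖U τ s z‖
            ≤ M * g τ * R ^ ω * (R * μ s) ^ α * ‖U τ s z‖ := by gcongr
          _ = _ := by ring
      · have h1 := hL1 s t hs hst z
        have h2 : (∫ τ in s..t, ‖H τ (U τ s z)‖ ^ p) =
            ∫ τ in s..t, h τ * (μ τ ^ (-γ)) ^ p * ‖U τ s z‖ ^ p := by
          refine intervalIntegral.integral_congr fun τ hτ => ?_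
          rw [Set.uIcc_of_le hst] at hτ
          exact hHQ τ (hs.trans hτ.1) _ (by rw [hPU s τ hs hτ.1, hPz, map_zero])
        rw [h2, hUz] at h1
        have h3 : L s z ≤ 0 := by
          have := (hL2 s hs z).2
          rwa [hzQ] at this
        have h4 := hL3 t ht x
        have h5 := (hL2 t ht x).1
        have h6 : 0 ≤ μ t ^ (-(p * γ)) * L t (P t x) := mul_nonneg (by positivity) h5
        have h7 : μ t ^ (p * γ) * (-L t ((1 - P t) x)) ≤
            (2 : ℝ) ^ (p - 1) * D * μ t ^ (p * ε) * ‖x‖ ^ p := by linarith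
        have h8 : -L t ((1 - P t) x) ≤ 2 ^ (p - 1) * D * (μ t ^ (ε - γ) * ‖x‖) ^ p := by
          rw [← le_div_iff₀' (by positivity)] at h7
          refine h7.trans (le_of_eq ?_)
          rw [Real.mul_rpow (by positivity) (norm_nonneg x), ← Real.rpow_mul hmt.le,
            sub_mul, Real.rpow_sub hmt, mul_comm p γ, mul_comm p ε]
          ring
        linarith
end
end

section
/- Let μ : [0,∞) → [1,∞) be a differentiable growth rate with K_μ := sup_{t ≥ 0} μ'(t)/μ(t) < +∞. Let X be a real Hilbert space, U : Δ → B(X) an evolution operator and P a projection valued function compatible with U such that ‖G(t,s)‖ ≤ M (μ'(s)/μ(s)) (μ(t)/μ(s))^{ω·sign(t−s)} μ(s)^α for all t,s ≥ 0 with t ≠ s, for some ω > 0, α ≥ 0 and M ≥ 1. Suppose there is γ > α such that for every H ∈ H^μ_{γ,2}(P) there exist ε ≥ 0, D > 0 and a strongly continuous operator valued function W : [0,∞) → B(X) with W(t)* = W(t) satisfying: for all t ≥ s ≥ 0 and x ∈ X, ⟨U(t,s)*W(t)U(t,s)x + ∫_s^t U(τ,s)*H(τ)*H(τ)U(τ,s)x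 dτ, x⟩ ≤ ⟨W(s)x, x⟩; and for all t ≥ 0, x ∈ X, ⟨W(t)P(t)x, P(t)x⟩ ≥ 0, ⟨W(t)Q(t)x, Q(t)x⟩ ≤ 0, and μ(t)^{−2γ}⟨W(t)P(t)x, P(t)x⟩ − μ(t)^{2γ}⟨W(t)Q(t)x, Q(t)x⟩ ≤ D μ(t)^{2ε} ‖x‖². Then U has a nonuniform μ-dichotomy with projection valued function P. -/
open Real MeasureTheory Filter

noncomputable section

variable {X : Type*} [NormedAddCommGroup X] [NormedSpace ℝ X]

open RealInnerProductSpace in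
theorem aux_weak_meas {E : Type*} [NormedAddCommGroup E] [InnerProductSpace ℝ E] [CompleteSpace E]
    (f : ℝ → E) (hf : ∀ z, Continuous fun τ => ⟪f τ, z⟫) : StronglyMeasurable f := by
  classical
  let d := TopologicalSpace.denseSeq ℝ
  let Y : ℕ → Submodule ℝ E := fun k => Submodule.span ℝ ((fun i => f (d i)) '' Set.Iio k)
  have : ∀ k, FiniteDimensional ℝ (Y k) := fun k =>
    FiniteDimensional.span_of_finite ℝ ((Set.finite_Iio k).image _)
  have hmono : Monotone Y := fun a b hab => Submodule.span_mono
    (Set.image_mono (Set.Iio_subset_Iio hab))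
  have hmem : ∀ τ, f τ ∈ (⨆ i, Y i).topologicalClosure := by
    intro τ
    rw [← Submodule.orthogonal_orthogonal_eq_closure]
    rw [Submodule.mem_orthogonal']
    intro z hz
    have h0 : ∀ i, ⟪f (d i), z⟫ = 0 := by
      intro i
      rw [Submodule.mem_orthogonal] at hz
      apply hz
      apply Submodule.mem_iSup_of_mem (i + 1)
      apply Submodule.subset_span
      exact ⟨i, Nat.lt_succ_self i, rfl⟩
    have : (fun τ => ⟪f τ, z⟫) = fun _ => (0:ℝ) := by
      apply Continuous.ext_on (TopologicalSpace.denseRange_denseSeq ℝ) (hf z) continuous_const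
      rintro _ ⟨i, rfl⟩
      exact h0 i
    exact congrFun this τ
  refine stronglyMeasurable_of_tendsto (f := fun n τ => (Y n).starProjection (f τ)) atTop
    (fun n => ?_) ?_
  · apply Continuous.stronglyMeasurable
    let b := stdOrthonormalBasis ℝ (Y n)
    have : (fun τ => (Y n).starProjection (f τ)) = fun τ => ∑ i, ⟪(b i : E), f τ⟫ • (b i : E) := by
      funext τ
      rw [Submodule.starProjection_apply, b.orthogonalProjectionOnto_apply_eq_sum]
      simp
    rw [this]
    refine continuous_finsetSum _ fun i _ => Continuous.smul ?_ continuous_const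
    simpa only [real_inner_comm] using hf (b i : E)
  · rw [tendsto_pi_nhds]
    intro τ
    have := Submodule.starProjection_tendsto_closure_iSup Y hmono (f τ)
    rwa [Submodule.starProjection_eq_self_iff.2 (hmem τ)] at this

theorem aux_bdd {E : Type*} [NormedAddCommGroup E] [NormedSpace ℝ E] [CompleteSpace E]
    (A : ℝ → E →L[ℝ] E) (s t : ℝ) (hA : ∀ x, ContinuousOn (fun τ => A τ x) (Set.Icc s t)) :
    ∃ C, 0 ≤ C ∧ ∀ τ ∈ Set.Icc s t, ‖A τ‖ ≤ C := by
  obtain ⟨C, hC⟩ := banach_steinhaus (g := fun τ : Set.Icc s t => A τ) (by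
    intro x
    obtain ⟨C, hC⟩ := isCompact_Icc.exists_bound_of_continuousOn (hA x)
    exact ⟨C, fun i => hC i i.2⟩)
  exact ⟨max C 0, le_max_right _ _, fun τ hτ => (hC ⟨τ, hτ⟩).trans (le_max_left _ _)⟩

/-- strongly continuous families applied to continuous curves, on compact intervals. -/
theorem aux_comp {E : Type*} [NormedAddCommGroup E] [NormedSpace ℝ E] [CompleteSpace E]
    (A : ℝ → E →L[ℝ] E) (v : ℝ → E) (s t : ℝ)
    (hA : ∀ x, ContinuousOn (fun τ => A τ x) (Set.Icc s t))
    (hv : ContinuousOn v (Set.Icc s t)) : ContinuousOn (fun τ => A τ (v τ)) (Set.Icc s t) := by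
  obtain ⟨C, hC0, hC⟩ := aux_bdd A s t hA
  intro τ₀ hτ₀
  have h1 : Tendsto (fun τ => A τ (v τ₀)) (nhdsWithin τ₀ (Set.Icc s t)) (nhds (A τ₀ (v τ₀))) :=
    hA (v τ₀) τ₀ hτ₀
  have h2 : Tendsto (fun τ => A τ (v τ - v τ₀)) (nhdsWithin τ₀ (Set.Icc s t)) (nhds 0) := by
    have h3 : Tendsto (fun τ => C * ‖v τ - v τ₀‖) (nhdsWithin τ₀ (Set.Icc s t)) (nhds 0) := by
      have := ((hv τ₀ hτ₀).sub_const (v τ₀)).norm.const_mul C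
      simpa using this
    refine squeeze_zero_norm' ?_ h3
    filter_upwards [self_mem_nhdsWithin] with τ hτ
    exact (A τ).le_of_opNorm_le (hC τ hτ) _
  have := h1.add h2
  simp only [map_sub, add_sub_cancel, add_zero] at this
  exact this

theorem aux_Ici {E : Type*} [TopologicalSpace E] (f : ℝ → E)
    (h : ∀ T, ContinuousOn f (Set.Icc 0 T)) : ContinuousOn f (Set.Ici 0) := by
  intro x hx
  have h1 := h (x + 1) x ⟨hx, by linarith⟩
  refine h1.mono_of_mem_nhdsWithin ?_
  rw [← Set.Ici_inter_Iic]
  exact Filter.inter_mem self_mem_nhdsWithin (mem_nhdsWithin_of_mem_nhds (Iic_mem_nhds (by linarith)))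

open RealInnerProductSpace in
theorem aux_integral {E : Type*} [NormedAddCommGroup E] [InnerProductSpace ℝ E] [CompleteSpace E]
    (A : ℝ → E →L[ℝ] E) (s t : ℝ) (hst : s ≤ t)
    (hA : ∀ x, ContinuousOn (fun τ => A τ x) (Set.Icc s t)) (x : E) :
    ⟪∫ τ in s..t, ContinuousLinearMap.adjoint (A τ) (A τ x), x⟫ = ∫ τ in s..t, ‖A τ x‖ ^ 2 := by
  let B : ℝ → E →L[ℝ] E := fun τ => A (Set.projIcc s t hst τ)
  have hB : ∀ x, Continuous fun τ => B τ x := fun x =>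
    (continuousOn_iff_continuous_domRestrict.1 (hA x)).comp continuous_projIcc
  have hBA : ∀ τ ∈ Set.Icc s t, B τ = A τ := fun τ hτ => by
    simp [B, Set.projIcc_of_mem hst hτ]
  obtain ⟨C, hC0, hC⟩ := aux_bdd A s t hA
  have hBC : ∀ τ, ‖B τ‖ ≤ C := fun τ => hC _ (Set.projIcc s t hst τ).2
  have hm : StronglyMeasurable fun τ => ContinuousLinearMap.adjoint (B τ) (B τ x) := by
    apply aux_weak_meas
    intro z
    simp only [ContinuousLinearMap.adjoint_inner_left]
    exact (hB x).inner (hB z)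
  have hint : IntervalIntegrable (fun τ => ContinuousLinearMap.adjoint (B τ) (B τ x)) volume s t := by
    refine (intervalIntegrable_const (c := C * (C * ‖x‖))).mono_fun hm.aestronglyMeasurable ?_
    refine Filter.Eventually.of_forall fun τ => ?_
    have h1 : ‖ContinuousLinearMap.adjoint (B τ)‖ ≤ C := by
      rw [LinearIsometryEquiv.norm_map]; exact hBC τ
    have h2 := (B τ).le_of_opNorm_le (hBC τ) x
    have h3 := (ContinuousLinearMap.adjoint (B τ)).le_of_opNorm_le h1 (B τ x)
    refine h3.trans (le_trans ?_ (le_abs_self _))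
    gcongr
  have e1 : ∫ τ in s..t, ContinuousLinearMap.adjoint (A τ) (A τ x) =
      ∫ τ in s..t, ContinuousLinearMap.adjoint (B τ) (B τ x) := by
    apply intervalIntegral.integral_congr
    intro τ hτ
    rw [Set.uIcc_of_le hst] at hτ
    simp only [hBA τ hτ]
  have e2 : ∫ τ in s..t, ‖A τ x‖ ^ 2 = ∫ τ in s..t, ‖B τ x‖ ^ 2 := by
    apply intervalIntegral.integral_congr
    intro τ hτ
    rw [Set.uIcc_of_le hst] at hτ
    simp only [hBA τ hτ]
  rw [e1, e2, real_inner_comm]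
  have := (innerSL ℝ x).intervalIntegral_comp_comm hint
  simp only [innerSL_apply_apply] at this
  rw [← this]
  congr 1
  funext τ
  rw [ContinuousLinearMap.adjoint_inner_right, real_inner_self_eq_norm_sq]

theorem aux_select (Bad : ℕ → ℝ → Prop) (hanti : ∀ N N' t, N ≤ N' → 0 ≤ t → Bad N' t → Bad N t) (c : ℝ)
    (hc : 0 ≤ c)
    (h1 : ∀ n : ℕ, ∃ N, ∀ t ∈ Set.Icc (2 * (n:ℝ) + c) (2 * n + c + 1), ¬ Bad N t)
    (h2 : ∀ T : ℕ → ℝ, (∀ n : ℕ, T n ∈ Set.Icc (2 * (n:ℝ) + c) (2 * n + c + 1)) →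
      ∃ N, ∀ n, ¬ Bad N (T n)) :
    ∃ N, ∀ n : ℕ, ∀ t ∈ Set.Icc (2 * (n:ℝ) + c) (2 * n + c + 1), ¬ Bad N t := by
  classical
  have key : ∀ n : ℕ, ∃ t ∈ Set.Icc (2 * (n:ℝ) + c) (2 * n + c + 1),
      ∀ N < Nat.find (h1 n), Bad N t := by
    intro n
    by_cases h0 : Nat.find (h1 n) = 0
    · exact ⟨2 * n + c, ⟨le_rfl, by linarith⟩, fun N hN => by omega⟩
    · have := Nat.find_min (h1 n) (m := Nat.find (h1 n) - 1) (by omega)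
      push Not at this
      obtain ⟨t, ht, hb⟩ := this
      exact ⟨t, ht, fun N hN => hanti _ _ _ (by omega) (le_trans (by positivity) ht.1) hb⟩
  choose T hT hTb using key
  obtain ⟨N, hN⟩ := h2 T hT
  refine ⟨N, fun n t ht hb => ?_⟩
  have h3 : Nat.find (h1 n) ≤ N := by
    by_contra hlt
    exact hN n (hTb n N (by omega))
  exact Nat.find_spec (h1 n) t ht (hanti _ _ _ h3 (le_trans (by positivity) ht.1) hb)

/-- smoothing of a step function -/
theorem aux_rho (T : ℕ → ℝ) (c : ℝ)
    (hT : ∀ n : ℕ, T n ∈ Set.Icc (2 * (n:ℝ) + c) (2 * n + c + 1)) :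
    ∃ r : ℝ → ℝ, Continuous r ∧ (∀ n : ℕ, ∀ τ ∈ Set.Icc (2 * (n:ℝ)) (2 * n + 1), r τ = T n) ∧
      ∀ τ, 0 ≤ τ → τ - 2 + c ≤ r τ ∧ r τ ≤ τ + c + 2 := by
  have hmT : Monotone T := by
    apply monotone_nat_of_le_succ
    intro n
    have h1 := (hT n).2
    have h2 := (hT (n+1)).1
    push_cast at h2
    linarith
  let g : ℝ → ℝ := fun x => T ⌊x / 2⌋₊
  have hg : Monotone g := fun a b hab => hmT (Nat.floor_mono (by linarith))
  have hgi : ∀ a b, IntervalIntegrable g volume a b := fun a b => hg.intervalIntegrable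
  have hgb : ∀ x, 0 ≤ x → x - 2 + c ≤ g x ∧ g x ≤ x + c + 1 := by
    intro x hx
    have h1 := hT ⌊x/2⌋₊
    have h2 := Nat.floor_le (a := x/2) (by linarith)
    have h3 := Nat.lt_floor_add_one (x/2)
    constructor
    · have := h1.1; simp only [g]; linarith
    · have := h1.2; simp only [g]; linarith
  refine ⟨fun τ => ∫ x in τ..τ+1, g x, ?_, ?_, ?_⟩
  · have hc := intervalIntegral.continuous_primitive hgi 0
    have : (fun τ => ∫ x in τ..τ+1, g x) =
        fun τ => (∫ x in (0:ℝ)..τ+1, g x) - ∫ x in (0:ℝ)..τ, g x := by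
      funext τ
      rw [intervalIntegral.integral_interval_sub_left (hgi _ _) (hgi _ _)]
    rw [this]
    exact (hc.comp (continuous_add_const 1)).sub hc
  · intro n τ hτ
    have : ∫ x in τ..τ+1, g x = ∫ x in τ..τ+1, T n := by
      apply intervalIntegral.integral_congr_ae
      have : ∀ᵐ x : ℝ, x ≠ 2 * n + 2 := by
        simp [ae_iff]
      filter_upwards [this] with x hx hxm
      rw [Set.uIoc_of_le (by linarith)] at hxm
      have : ⌊x / 2⌋₊ = n := by
        rw [Nat.floor_eq_iff (by have := hτ.1; have := hxm.1; have : (0:ℝ) ≤ n := by positivity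
                                 linarith)]
        have h4 : x < 2 * n + 2 := lt_of_le_of_ne (by linarith [hxm.2, hτ.2]) hx
        constructor <;> linarith [hxm.1, hτ.1]
      simp only [g, this]
    simp only [this]
    simp
  · intro τ hτ
    constructor
    · have := intervalIntegral.integral_mono_on (a := τ) (b := τ+1) (f := fun _ => τ - 2 + c) (g := g)
        (by linarith) intervalIntegrable_const (hgi _ _)
        (fun x hx => by linarith [(hgb x (by linarith [hx.1])).1, hx.1])
      simpa using this
    · have := intervalIntegral.integral_mono_on (a := τ) (b := τ+1) (g := fun _ => τ + c + 2) (f := g)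
        (by linarith) (hgi _ _) intervalIntegrable_const
        (fun x hx => by linarith [(hgb x (by linarith [hx.1])).2, hx.2])
      simpa using this

theorem aux_mu (μ : ℝ → ℝ) (K : ℝ) (hgr : IsGrowthRate μ)
    (hdiff : ∀ t, 0 ≤ t → DifferentiableAt ℝ μ t)
    (hK : ∀ t, 0 ≤ t → deriv μ t / μ t ≤ K) :
    (∀ t, 0 ≤ t → 0 ≤ deriv μ t / μ t) ∧
    (∀ s t, 0 ≤ s → s ≤ t → μ t ≤ Real.exp (K * (t - s)) * μ s) := by
  obtain ⟨h1, hm, -, -⟩ := hgr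
  have hpos : ∀ t, 0 ≤ t → 0 < μ t := fun t ht => by linarith [h1 t ht]
  constructor
  · intro t ht
    apply div_nonneg _ (hpos t ht).le
    rw [← (hdiff t ht).derivWithin (uniqueDiffOn_Ici (0:ℝ) t ht)]
    exact hm.derivWithin_nonneg
  · intro s t hs hst
    have hd : ∀ x, 0 ≤ x → HasDerivAt (fun x => Real.log (μ x)) (deriv μ x / μ x) x := fun x hx =>
      (hdiff x hx).hasDerivAt.log (hpos x hx).ne'
    have := Convex.image_sub_le_mul_sub_of_deriv_le (convex_Ici (0:ℝ)) (C := K)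
      (f := fun x => Real.log (μ x))
      (fun x hx => (hd x hx).continuousAt.continuousWithinAt)
      (fun x hx => (hd x (interior_subset hx)).differentiableAt.differentiableWithinAt)
      (fun x hx => by rw [(hd x (interior_subset hx)).deriv]; exact hK x (interior_subset hx))
      s hs t (hs.trans hst) hst
    rw [← Real.log_le_log_iff (hpos t (hs.trans hst)) (mul_pos (Real.exp_pos _) (hpos s hs)),
      Real.log_mul (Real.exp_pos _).ne' (hpos s hs).ne', Real.log_exp]
    linarith

structure AuxCtx {E : Type*} [NormedAddCommGroup E] [NormedSpace ℝ E] (μ : ℝ → ℝ)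
    (U V : ℝ → ℝ → E →L[ℝ] E) (P : ℝ → E →L[ℝ] E) (K M ω α : ℝ) : Prop where
  h1 : ∀ t, 0 ≤ t → 1 ≤ μ t
  mono : ∀ s t, 0 ≤ s → s ≤ t → μ s ≤ μ t
  cont : ContinuousOn μ (Set.Ici 0)
  K1 : 1 ≤ K
  M1 : 1 ≤ M
  ω0 : 0 < ω
  α0 : 0 ≤ α
  d0 : ∀ t, 0 ≤ t → 0 ≤ deriv μ t / μ t
  dK : ∀ t, 0 ≤ t → deriv μ t / μ t ≤ K
  lip : ∀ s t, 0 ≤ s → s ≤ t → μ t ≤ Real.exp (K * (t - s)) * μ s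
  hU : IsEvolutionOperator U
  hP : IsProjectionValued P
  hC : CompatibleProjection U V P
  gP : ∀ s t, 0 ≤ s → s < t → ‖(U t s).comp (P s)‖ ≤
    M * (deriv μ s / μ s) * (μ t / μ s) ^ ω * μ s ^ α
  gQ : ∀ s t, 0 ≤ s → s < t → ‖(V s t).comp (1 - P t)‖ ≤
    M * (deriv μ t / μ t) * (μ t / μ s) ^ ω * μ t ^ α

theorem aux_mkctx {E : Type*} [NormedAddCommGroup E] [NormedSpace ℝ E]
    (μ : ℝ → ℝ) (Kμ : ℝ) (hgr : IsGrowthRate μ)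
    (hdiff : ∀ t, 0 ≤ t → DifferentiableAt ℝ μ t)
    (hKμ : ∀ t, 0 ≤ t → deriv μ t / μ t ≤ Kμ)
    (U V : ℝ → ℝ → E →L[ℝ] E) (P : ℝ → E →L[ℝ] E)
    (hU : IsEvolutionOperator U) (hP : IsProjectionValued P)
    (hC : CompatibleProjection U V P)
    (M ω α : ℝ) (hω : 0 < ω) (hα : 0 ≤ α) (hM : 1 ≤ M)
    (hG : ∀ t s, 0 ≤ t → 0 ≤ s → t ≠ s →
      ‖greenFunction U V P t s‖ ≤
        M * (deriv μ s / μ s) * (μ t / μ s) ^ (ω * Real.sign (t - s)) * μ s ^ α) :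
    AuxCtx μ U V P (max Kμ 1) M ω α := by
  have hK : ∀ t, 0 ≤ t → deriv μ t / μ t ≤ max Kμ 1 := fun t ht => (hKμ t ht).trans (le_max_left _ _)
  obtain ⟨hd, hl⟩ := aux_mu μ _ hgr hdiff hK
  refine ⟨hgr.1, fun s t hs hst => hgr.2.1 hs (hs.trans hst) hst,
    fun t ht => (hdiff t ht).continuousAt.continuousWithinAt, le_max_right _ _, hM, hω, hα, hd, hK, hl,
    hU, hP, hC, ?_, ?_⟩
  · intro s t hs hst
    have := hG t s (hs.trans hst.le) hs hst.ne'
    rwa [greenFunction, if_pos hst, Real.sign_of_pos (by linarith), mul_one] at this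
  · intro s t hs hst
    have := hG s t hs (hs.trans hst.le) hst.ne
    rw [greenFunction, if_neg hst.not_gt, if_pos hst, Real.sign_of_neg (by linarith), norm_neg,
      mul_neg_one, Real.rpow_neg, ← Real.inv_rpow, inv_div] at this
    · exact this
    · have := hgr.1 s hs; have := hgr.1 t (hs.trans hst.le); positivity
    · have := hgr.1 s hs; have := hgr.1 t (hs.trans hst.le); positivity

namespace AuxCtx
variable {E : Type*} [NormedAddCommGroup E] [NormedSpace ℝ E] {μ : ℝ → ℝ}
    {U V : ℝ → ℝ → E →L[ℝ] E} {P : ℝ → E →L[ℝ] E} {K M ω α : ℝ}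

theorem pos (h : AuxCtx μ U V P K M ω α) {t : ℝ} (ht : 0 ≤ t) : 0 < μ t := by
  linarith [h.h1 t ht]

theorem V1 (h : AuxCtx μ U V P K M ω α) {r τ t : ℝ} (hr : 0 ≤ r) (h1 : r ≤ τ) (h2 : τ ≤ t) (x : E) :
    U τ r (V r t ((1 - P t) x)) = V τ t ((1 - P t) x) := by
  obtain ⟨c1, c2, c3, c4⟩ := h.hC
  set z := V r t ((1 - P t) x) with hz
  have hzr : (1 - P r) z = z := c2 r t hr (h1.trans h2) x
  have e1 : (1 - P τ) (U τ r z) = U τ r z := by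
    have := congrArg (fun A => A z) (c1 r τ hr h1)
    simp only [ContinuousLinearMap.comp_apply] at this
    have hz0 : P r z = 0 := by simpa using hzr
    simp [this, hz0]
  have e2 := c4 τ t (hr.trans h1) h2 (U τ r z)
  rw [e1] at e2
  have e3 : U t τ (U τ r z) = U t r z := congrArg (fun A => A z) (h.hU.2.1 r τ t hr h1 h2)
  rw [e3, hz, c3 r t hr (h1.trans h2)] at e2
  exact e2.symm

theorem V2 (h : AuxCtx μ U V P K M ω α) {r τ t : ℝ} (hr : 0 ≤ r) (h1 : r ≤ τ) (h2 : τ ≤ t) (x : E) :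
    V r τ ((1 - P τ) (V τ t ((1 - P t) x))) = V r t ((1 - P t) x) := by
  rw [h.hC.2.1 τ t (hr.trans h1) h2, ← h.V1 hr h1 h2]
  have := h.hC.2.2.2 r τ hr h1 (V r t ((1 - P t) x))
  rwa [h.hC.2.1 r t hr (h1.trans h2)] at this

theorem ratio (h : AuxCtx μ U V P K M ω α) {s t L : ℝ} (hs : 0 ≤ s) (hst : s ≤ t) (hL : t ≤ s + L) :
    μ t / μ s ≤ Real.exp (K * L) := by
  rw [div_le_iff₀ (h.pos hs)]
  refine (h.lip s t hs hst).trans ?_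
  have := h.K1
  have := (h.pos hs).le
  gcongr
  linarith

theorem ratio_rpow (h : AuxCtx μ U V P K M ω α) {s t L : ℝ} (hs : 0 ≤ s) (hst : s ≤ t)
    (hL : t ≤ s + L) {p : ℝ} (hp : 0 ≤ p) :
    (μ t / μ s) ^ p ≤ Real.exp (K * L * p) := by
  rw [Real.exp_mul]
  have := h.pos hs
  have := h.pos (hs.trans hst)
  exact Real.rpow_le_rpow (by positivity) (h.ratio hs hst hL) hp

theorem growP' (h : AuxCtx μ U V P K M ω α) {s t L : ℝ} (hs : 0 ≤ s) (hst : s < t)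
    (hL : t ≤ s + L) : ‖(U t s).comp (P s)‖ ≤
      M * (deriv μ s / μ s) * Real.exp (K * L * ω) * μ s ^ α := by
  refine (h.gP s t hs hst).trans ?_
  have := h.ratio_rpow hs hst.le hL h.ω0.le
  have := h.M1
  have := h.d0 s hs
  have := h.pos hs
  gcongr

theorem growQ' (h : AuxCtx μ U V P K M ω α) {s t L : ℝ} (hs : 0 ≤ s) (hst : s < t)
    (hL : t ≤ s + L) : ‖(V s t).comp (1 - P t)‖ ≤
      M * (deriv μ t / μ t) * Real.exp (K * L * ω) * μ t ^ α := by
  refine (h.gQ s t hs hst).trans ?_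
  have := h.ratio_rpow hs hst.le hL h.ω0.le
  have := h.M1
  have := h.d0 t (hs.trans hst.le)
  have := h.pos (hs.trans hst.le)
  gcongr

theorem boundP (h : AuxCtx μ U V P K M ω α) {s : ℝ} (hs : 0 ≤ s) :
    ‖P s‖ ≤ M * K * Real.exp (K * 1 * ω) * μ s ^ α := by
  have hK := h.K1
  have hM := h.M1
  have hμ := h.pos hs
  refine ContinuousLinearMap.opNorm_le_bound _ (by positivity) fun x => ?_
  have hc : Tendsto (fun t => U t s (P s x)) (nhdsWithin s (Set.Ioi s)) (nhds (U s s (P s x))) := by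
    have h1 := h.hU.2.2 (P s x) (s, s) ⟨hs, le_rfl⟩
    have h2 : Tendsto (fun t : ℝ => (t, s)) (nhdsWithin s (Set.Ioi s))
        (nhdsWithin (s, s) {q : ℝ × ℝ | 0 ≤ q.2 ∧ q.2 ≤ q.1}) := by
      apply tendsto_nhdsWithin_of_tendsto_nhds_of_eventually_within
      · have : Continuous fun t : ℝ => (t, s) := by fun_prop
        exact (this.tendsto s).mono_left nhdsWithin_le_nhds
      · filter_upwards [self_mem_nhdsWithin] with t ht
        exact ⟨hs, le_of_lt ht⟩
    exact h1.tendsto.comp h2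
  rw [h.hU.1 s hs] at hc
  refine le_of_tendsto hc.norm ?_
  filter_upwards [Ioo_mem_nhdsGT (show s < s + 1 by linarith)] with t ht
  refine ((U t s).comp (P s)).le_of_opNorm_le ?_ x
  refine (h.growP' (L := 1) hs ht.1 ht.2.le).trans ?_
  have := h.dK s hs
  gcongr

theorem growP (h : AuxCtx μ U V P K M ω α) {s t L : ℝ} (hs : 0 ≤ s) (hst : s ≤ t) (hL1 : 1 ≤ L)
    (hL : t ≤ s + L) : ‖(U t s).comp (P s)‖ ≤ (1 + M * K * Real.exp (K * L * ω)) * μ s ^ α := by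
  have hK := h.K1
  have hM := h.M1
  have hμ := h.pos hs
  have hω := h.ω0
  have hb : M * K * Real.exp (K * L * ω) * μ s ^ α ≤
      (1 + M * K * Real.exp (K * L * ω)) * μ s ^ α := by
    gcongr; linarith
  refine le_trans ?_ hb
  rcases hst.eq_or_lt with rfl | hlt
  · rw [h.hU.1 s hs]
    refine le_trans (le_of_eq ?_) ((h.boundP hs).trans ?_)
    · congr 1
    · gcongr
  · refine (h.growP' hs hlt hL).trans ?_
    have := h.dK s hs
    gcongr

theorem growQ (h : AuxCtx μ U V P K M ω α) {s t L : ℝ} (hs : 0 ≤ s) (hst : s ≤ t) (hL1 : 1 ≤ L)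
    (hL : t ≤ s + L) :
    ‖(V s t).comp (1 - P t)‖ ≤ (1 + M * K * Real.exp (K * L * ω)) * μ t ^ α := by
  have hK := h.K1
  have hM := h.M1
  have ht := hs.trans hst
  have hμ := h.pos ht
  have hω := h.ω0
  rcases hst.eq_or_lt with rfl | hlt
  · have e : (V s s).comp (1 - P s) = 1 - P s := by
      ext x
      have := h.hC.2.2.2 s s hs le_rfl x
      rw [h.hU.1 s hs] at this
      simpa using this
    rw [e]
    refine (norm_sub_le _ _).trans ?_
    rw [add_mul, one_mul]
    have h1 : 1 ≤ μ s ^ α := Real.one_le_rpow (h.h1 s hs) h.α0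
    refine add_le_add (ContinuousLinearMap.norm_id_le.trans h1) ((h.boundP hs).trans ?_)
    gcongr
  · have hb : M * K * Real.exp (K * L * ω) * μ t ^ α ≤
      (1 + M * K * Real.exp (K * L * ω)) * μ t ^ α := by
      gcongr; linarith
    refine le_trans ?_ hb
    refine (h.growQ' hs hlt hL).trans ?_
    have := h.dK t ht
    gcongr

end AuxCtx

theorem aux_window_s17 (f : ℝ → ℝ) (s t a m B : ℝ) (hf : ContinuousOn f (Set.Icc s t))
    (h0 : ∀ τ ∈ Set.Icc s t, 0 ≤ f τ) (hsa : s ≤ a) (hat : a + 1 ≤ t)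
    (hm : ∀ τ ∈ Set.Icc a (a + 1), m ≤ f τ) (hB : ∫ τ in s..t, f τ ≤ B) : m ≤ B := by
  have hi : ∀ x y, s ≤ x → x ≤ y → y ≤ t → IntervalIntegrable f volume x y := by
    intro x y hx hxy hy
    apply ContinuousOn.intervalIntegrable
    rw [Set.uIcc_of_le hxy]
    exact hf.mono (Set.Icc_subset_Icc hx hy)
  have e1 := intervalIntegral.integral_add_adjacent_intervals (hi s a le_rfl hsa (by linarith))
    (hi a t hsa (by linarith) le_rfl)
  have e2 := intervalIntegral.integral_add_adjacent_intervals (hi a (a+1) hsa (by linarith) hat)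
    (hi (a+1) t (by linarith) hat le_rfl)
  have p1 : 0 ≤ ∫ τ in s..a, f τ := intervalIntegral.integral_nonneg hsa
    fun u hu => h0 u ⟨hu.1, by linarith [hu.2]⟩
  have p2 : 0 ≤ ∫ τ in (a+1)..t, f τ := intervalIntegral.integral_nonneg hat
    fun u hu => h0 u ⟨by linarith [hu.1], hu.2⟩
  have p3 := intervalIntegral.integral_mono_on (a := a) (b := a+1) (f := fun _ => m) (g := f)
        (by linarith) intervalIntegrable_const (hi a (a+1) hsa (by linarith) hat) hm
  simp only [intervalIntegral.integral_const, add_sub_cancel_left, one_smul] at p3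
  linarith

namespace AuxCtx

theorem HU {E : Type*} [NormedAddCommGroup E] [NormedSpace ℝ E] [CompleteSpace E] {μ : ℝ → ℝ}
    {U V : ℝ → ℝ → E →L[ℝ] E} {P : ℝ → E →L[ℝ] E} {K M ω α : ℝ}
    (h : AuxCtx μ U V P K M ω α)
    (H : ℝ → E →L[ℝ] E) (hH : ∀ x : E, ContinuousOn (fun t => H t x) (Set.Ici 0))
    {s t : ℝ} (hs : 0 ≤ s) (z : E) :
    ContinuousOn (fun τ => H τ (U τ s z)) (Set.Icc s t) := by
  apply aux_comp H (fun τ => U τ s z)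
  · exact fun x => (hH x).mono fun τ hτ => hs.trans hτ.1
  · have : Continuous fun t : ℝ => (t, s) := by fun_prop
    exact (h.hU.2.2 z).comp this.continuousOn fun τ hτ => ⟨hs, hτ.1⟩

open RealInnerProductSpace in
theorem lyap {E : Type*} [NormedAddCommGroup E] [InnerProductSpace ℝ E] [CompleteSpace E] {μ : ℝ → ℝ}
    {U V : ℝ → ℝ → E →L[ℝ] E} {P : ℝ → E →L[ℝ] E} {K M ω α γ ε D : ℝ}
    (h : AuxCtx μ U V P K M ω α)
    (H W : ℝ → E →L[ℝ] E) (hH : ∀ x : E, ContinuousOn (fun t => H t x) (Set.Ici 0)) (hD : 0 < D)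
    (hW1 : ∀ s t, 0 ≤ s → s ≤ t → ∀ x : E,
          ⟪ContinuousLinearMap.adjoint (U t s) (W t (U t s x)) +
              ∫ τ in s..t, ContinuousLinearMap.adjoint (U τ s)
                (ContinuousLinearMap.adjoint (H τ) (H τ (U τ s x))), x⟫ ≤
            ⟪W s x, x⟫)
    (hW2 : ∀ t, 0 ≤ t → ∀ x : E,
          0 ≤ ⟪W t (P t x), P t x⟫ ∧ ⟪W t ((1 - P t) x), (1 - P t) x⟫ ≤ 0 ∧
          μ t ^ (-(2 * γ)) * ⟪W t (P t x), P t x⟫ -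
              μ t ^ (2 * γ) * ⟪W t ((1 - P t) x), (1 - P t) x⟫ ≤
            D * μ t ^ (2 * ε) * ‖x‖ ^ 2) :
    (∀ s t, 0 ≤ s → s ≤ t → ∀ x : E, ∫ τ in s..t, ‖H τ (U τ s (P s x))‖ ^ 2 ≤
      (√D * μ s ^ (ε + γ) * ‖x‖) ^ 2) ∧
    (∀ s t, 0 ≤ s → s ≤ t → ∀ x : E, ∫ τ in s..t, ‖H τ (U τ s (V s t ((1 - P t) x)))‖ ^ 2 ≤
      (√D * μ t ^ (ε - γ) * ‖x‖) ^ 2) := by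
  have key : ∀ s t, 0 ≤ s → s ≤ t → ∀ y : E, ⟪W t (U t s y), U t s y⟫ +
      ∫ τ in s..t, ‖H τ (U τ s y)‖ ^ 2 ≤ ⟪W s y, y⟫ := by
    intro s t hs hst y
    have h1 := hW1 s t hs hst y
    have h2 := aux_integral (fun τ => (H τ).comp (U τ s)) s t hst (fun x => h.HU H hH hs x) y
    simp only [ContinuousLinearMap.adjoint_comp, ContinuousLinearMap.comp_apply] at h2
    rwa [inner_add_left, ContinuousLinearMap.adjoint_inner_left, h2] at h1
  constructor
  · intro s t hs hst x
    have h1 := key s t hs hst (P s x)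
    have e : U t s (P s x) = P t (U t s x) :=
      (congrArg (fun A => A x) (h.hC.1 s t hs hst)).symm
    have h2 := (hW2 t (hs.trans hst) (U t s x)).1
    rw [← e] at h2
    obtain ⟨h3, h4, h5⟩ := hW2 s hs x
    have hμ := h.pos hs
    have hp : 0 < μ s ^ (2 * γ) := by positivity
    have h6 : μ s ^ (-(2 * γ)) * ⟪W s (P s x), P s x⟫ ≤ D * μ s ^ (2 * ε) * ‖x‖ ^ 2 := by
      nlinarith
    rw [Real.rpow_neg hμ.le, inv_mul_le_iff₀ hp] at h6
    have h7 : (√D * μ s ^ (ε + γ) * ‖x‖) ^ 2 = μ s ^ (2 * γ) * (D * μ s ^ (2 * ε) * ‖x‖ ^ 2) := by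
      rw [mul_pow, mul_pow, Real.sq_sqrt hD.le, ← Real.rpow_natCast (μ s ^ (ε + γ)),
        ← Real.rpow_mul hμ.le]
      rw [show (ε + γ) * ((2:ℕ):ℝ) = 2 * γ + 2 * ε by push_cast; ring, Real.rpow_add hμ]
      ring
    rw [h7]
    linarith
  · intro s t hs hst x
    have h1 := key s t hs hst (V s t ((1 - P t) x))
    rw [h.hC.2.2.1 s t hs hst x] at h1
    have h2 := (hW2 s hs (V s t ((1 - P t) x))).2.1
    rw [h.hC.2.1 s t hs hst x] at h2
    obtain ⟨h3, h4, h5⟩ := hW2 t (hs.trans hst) x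
    have hμ := h.pos (hs.trans hst)
    have hp : 0 < μ t ^ (2 * γ) := by positivity
    have hp' : 0 < μ t ^ (-(2 * γ)) := by positivity
    have h6 : μ t ^ (2 * γ) * (-⟪W t ((1 - P t) x), (1 - P t) x⟫) ≤ D * μ t ^ (2 * ε) * ‖x‖ ^ 2 := by
      nlinarith
    have h7 : (√D * μ t ^ (ε - γ) * ‖x‖) ^ 2 = (D * μ t ^ (2 * ε) * ‖x‖ ^ 2) / μ t ^ (2 * γ) := by
      rw [mul_pow, mul_pow, Real.sq_sqrt hD.le, ← Real.rpow_natCast (μ t ^ (ε - γ)),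
        ← Real.rpow_mul hμ.le]
      rw [show (ε - γ) * ((2:ℕ):ℝ) = 2 * ε - 2 * γ by push_cast; ring, Real.rpow_sub hμ]
      ring
    rw [h7]
    rw [mul_comm, ← le_div_iff₀ hp] at h6
    linarith

theorem dhalf {E : Type*} [NormedAddCommGroup E] [NormedSpace ℝ E] {μ : ℝ → ℝ}
    {U V : ℝ → ℝ → E →L[ℝ] E} {P : ℝ → E →L[ℝ] E} {K M ω α : ℝ}
    (h : AuxCtx μ U V P K M ω α) {t e : ℝ} (ht : 0 ≤ t) (he : 0 < e) :
    (M * √K * e)⁻¹ * (M * (deriv μ t / μ t) * e) ≤ (deriv μ t / μ t) ^ (1 / (2:ℝ)) := by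
  have hK := h.K1
  have hM := h.M1
  have hd := h.d0 t ht
  have hdK := h.dK t ht
  rw [← Real.sqrt_eq_rpow, inv_mul_le_iff₀ (by positivity)]
  set d := deriv μ t / μ t
  have h1 : d ≤ √K * √d := by
    calc d = √d * √d := (Real.mul_self_sqrt hd).symm
      _ ≤ √K * √d := by gcongr
  calc M * d * e ≤ M * (√K * √d) * e := by gcongr
    _ = _ := by ring

theorem memP {E : Type*} [NormedAddCommGroup E] [NormedSpace ℝ E] [CompleteSpace E] {μ : ℝ → ℝ}
    {U V : ℝ → ℝ → E →L[ℝ] E} {P : ℝ → E →L[ℝ] E} {K M ω α : ℝ}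
    (h : AuxCtx μ U V P K M ω α) (γ L : ℝ) (ρ : ℝ → ℝ) (hρc : Continuous ρ)
    (hρ : ∀ τ, 0 ≤ τ → τ < ρ τ ∧ ρ τ ≤ τ + L) :
    MemHClass μ P γ 2 (fun τ => ((M * √K * Real.exp (K * L * ω))⁻¹ * μ τ ^ (γ - α)) •
      (U (ρ τ) τ).comp (P τ)) := by
  have hK := h.K1
  have hM := h.M1
  constructor
  · intro x
    have hc : ContinuousOn (fun τ => U (ρ τ) τ (P τ x)) (Set.Ici 0) := by
      apply aux_Ici
      intro T
      apply aux_comp (fun τ => U (ρ τ) τ) (fun τ => P τ x)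
      · intro z
        have : Continuous fun t : ℝ => (ρ t, t) := by fun_prop
        exact (h.hU.2.2 z).comp this.continuousOn fun τ hτ => ⟨hτ.1, (hρ τ hτ.1).1.le⟩
      · exact (h.hP.2 x).mono fun τ hτ => hτ.1
    have hμc : ContinuousOn (fun τ => μ τ ^ (γ - α)) (Set.Ici 0) :=
      h.cont.rpow_const fun τ hτ => Or.inl (h.pos hτ).ne'
    exact (continuousOn_const.mul hμc).smul hc
  · intro t ht x
    have hμ := h.pos ht
    have hd := h.d0 t ht
    refine le_trans ?_ (le_add_of_nonneg_right (by positivity))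
    have e1 : (U (ρ t) t).comp (P t) x = (U (ρ t) t).comp (P t) (P t x) := by
      have := congrArg (fun A => A x) (h.hP.1 t ht)
      simp only [ContinuousLinearMap.comp_apply] at this
      simp [this]
    have e2 := ((U (ρ t) t).comp (P t)).le_of_opNorm_le
      (h.growP' ht (hρ t ht).1 (hρ t ht).2) (P t x)
    rw [_root_.smul_apply, norm_smul, e1, Real.norm_of_nonneg (by positivity)]
    have e3 := h.dhalf (e := Real.exp (K * L * ω)) ht (Real.exp_pos _)
    calc _ ≤ ((M * √K * Real.exp (K * L * ω))⁻¹ * μ t ^ (γ - α)) *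
          (M * (deriv μ t / μ t) * Real.exp (K * L * ω) * μ t ^ α * ‖P t x‖) := by gcongr
      _ = ((M * √K * Real.exp (K * L * ω))⁻¹ * (M * (deriv μ t / μ t) * Real.exp (K * L * ω))) *
          (μ t ^ (γ - α) * μ t ^ α) * ‖P t x‖ := by ring
      _ = ((M * √K * Real.exp (K * L * ω))⁻¹ * (M * (deriv μ t / μ t) * Real.exp (K * L * ω))) *
          μ t ^ γ * ‖P t x‖ := by rw [← Real.rpow_add hμ, sub_add_cancel]
      _ ≤ _ := by gcongr

theorem memQ {E : Type*} [NormedAddCommGroup E] [NormedSpace ℝ E] [CompleteSpace E] {μ : ℝ → ℝ}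
    {U V : ℝ → ℝ → E →L[ℝ] E} {P : ℝ → E →L[ℝ] E} {K M ω α : ℝ}
    (h : AuxCtx μ U V P K M ω α) (γ : ℝ) :
    MemHClass μ P γ 2 (fun τ => ((M * √K * Real.exp (K * 1 * ω))⁻¹ * min τ 1 * μ τ ^ (-γ - α)) •
      (V (max (τ - 1) 0) τ).comp (1 - P τ)) := by
  have hK := h.K1
  have hM := h.M1
  have hρ : ∀ τ : ℝ, 0 ≤ τ → 0 ≤ max (τ - 1) 0 ∧ max (τ - 1) 0 ≤ τ ∧ τ ≤ max (τ - 1) 0 + 1 :=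
    fun τ hτ => ⟨le_max_right _ _, max_le (by linarith) hτ, by linarith [le_max_left (τ - 1) 0]⟩
  constructor
  · intro x
    have hc : ContinuousOn (fun τ => V (max (τ - 1) 0) τ ((1 - P τ) x)) (Set.Ici 0) := by
      intro τ₀ hτ₀
      have hτ₀' : 0 ≤ τ₀ := hτ₀
      set z := V 0 τ₀ ((1 - P τ₀) x) with hz
      have hUz : ContinuousOn (fun τ => U τ 0 z) (Set.Ici 0) := by
        have : Continuous fun t : ℝ => (t, (0:ℝ)) := by fun_prop
        exact (h.hU.2.2 z).comp this.continuousOn fun τ hτ => ⟨le_rfl, hτ⟩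
      have hQx : ContinuousOn (fun τ => (1 - P τ) x) (Set.Ici 0) := by
        simp only [_root_.sub_apply]
        exact continuousOn_const.sub (h.hP.2 x)
      have hQz : ∀ τ, 0 ≤ τ → (1 - P τ) (U τ 0 z) = U τ 0 z := by
        intro τ hτ
        have hzr : (1 - P 0) z = z := h.hC.2.1 0 τ₀ le_rfl hτ₀ x
        have := congrArg (fun A => A z) (h.hC.1 0 τ le_rfl hτ)
        simp only [ContinuousLinearMap.comp_apply] at this
        have hz0 : P 0 z = 0 := by simpa using hzr
        simp [this, hz0]
      have hw0 : U τ₀ 0 z = (1 - P τ₀) x := h.hC.2.2.1 0 τ₀ le_rfl hτ₀ x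
      have hVw : ∀ τ, 0 ≤ τ → V (max (τ - 1) 0) τ ((1 - P τ) (U τ 0 z)) =
          U (max (τ - 1) 0) 0 z := by
        intro τ hτ
        obtain ⟨r0, r1, r2⟩ := hρ τ hτ
        rw [hQz τ hτ]
        have e1 := h.hC.2.2.2 _ τ r0 r1 (U (max (τ - 1) 0) 0 z)
        rw [hQz _ r0] at e1
        have e2 : U τ (max (τ - 1) 0) (U (max (τ - 1) 0) 0 z) = U τ 0 z :=
          congrArg (fun A => A z) (h.hU.2.1 0 _ τ le_rfl r0 r1)
        rw [← e2]
        exact e1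
      have t1 : Tendsto (fun τ => U (max (τ - 1) 0) 0 z) (nhdsWithin τ₀ (Set.Ici 0))
          (nhds (U (max (τ₀ - 1) 0) 0 z)) := by
        have hcm : Continuous fun τ : ℝ => max (τ - 1) 0 := by fun_prop
        exact (hUz.comp hcm.continuousOn (fun τ hτ => (hρ τ hτ).1)) τ₀ hτ₀
      have t2 : Tendsto (fun τ => V (max (τ - 1) 0) τ ((1 - P τ) ((1 - P τ) x - U τ 0 z)))
          (nhdsWithin τ₀ (Set.Ici 0)) (nhds 0) := by
        have t3 : Tendsto (fun τ => ((1 + M * K * Real.exp (K * 1 * ω)) * μ τ ^ α) *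
            ‖(1 - P τ) x - U τ 0 z‖) (nhdsWithin τ₀ (Set.Ici 0)) (nhds 0) := by
          have hμc : ContinuousOn (fun τ => μ τ ^ α) (Set.Ici 0) :=
            h.cont.rpow_const fun τ hτ => Or.inl (h.pos hτ).ne'
          have t5 : ContinuousOn (fun τ => ((1 + M * K * Real.exp (K * 1 * ω)) * μ τ ^ α) *
            ‖(1 - P τ) x - U τ 0 z‖) (Set.Ici 0) :=
            ((continuousOn_const (c := (1 + M * K * Real.exp (K * 1 * ω)))).mul hμc).mul
            (hQx.sub hUz).norm
          have := (t5 τ₀ hτ₀).tendsto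
          simpa only [hw0, sub_self, norm_zero, mul_zero, Pi.sub_apply] using this
        refine squeeze_zero_norm' ?_ t3
        filter_upwards [self_mem_nhdsWithin] with τ hτ
        obtain ⟨r0, r1, r2⟩ := hρ τ hτ
        exact ((V (max (τ - 1) 0) τ).comp (1 - P τ)).le_of_opNorm_le
          (h.growQ r0 r1 le_rfl r2) _
      have t4 := t2.add t1
      have e5 : V (max (τ₀ - 1) 0) τ₀ ((1 - P τ₀) x) = 0 + U (max (τ₀ - 1) 0) 0 z := by
        rw [← hVw τ₀ hτ₀, hQz τ₀ hτ₀, hw0, zero_add]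
      change Tendsto _ _ (nhds (V (max (τ₀ - 1) 0) τ₀ ((1 - P τ₀) x)))
      rw [e5]
      refine t4.congr' ?_
      filter_upwards [self_mem_nhdsWithin] with τ hτ
      rw [← hVw τ hτ, ← map_add, ← map_add, sub_add_cancel]
      congr 1
      have := congrArg (fun A => A x) (h.hP.1 τ hτ)
      simp only [ContinuousLinearMap.comp_apply] at this
      simp [this]
    have hμc : ContinuousOn (fun τ => μ τ ^ (-γ - α)) (Set.Ici 0) :=
      h.cont.rpow_const fun τ hτ => Or.inl (h.pos hτ).ne'
    have hmc : ContinuousOn (fun τ : ℝ => min τ 1) (Set.Ici 0) := by fun_prop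
    exact ((continuousOn_const.mul hmc).mul hμc).smul hc
  · intro t ht x
    have hμ := h.pos ht
    have hd := h.d0 t ht
    refine le_trans ?_ (le_add_of_nonneg_left (by positivity))
    rcases ht.eq_or_lt with rfl | htp
    · simp only [zero_le_one, min_eq_left, mul_zero, zero_mul, zero_smul,
        _root_.zero_apply, norm_zero]
      positivity
    obtain ⟨r0, r1, r2⟩ := hρ t ht
    have r3 : max (t - 1) 0 < t := max_lt (by linarith) htp
    have e1 : (V (max (t - 1) 0) t).comp (1 - P t) x =
        (V (max (t - 1) 0) t).comp (1 - P t) ((1 - P t) x) := by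
      have := congrArg (fun A => A x) (h.hP.1 t ht)
      simp only [ContinuousLinearMap.comp_apply] at this
      simp [this]
    have e2 := ((V (max (t - 1) 0) t).comp (1 - P t)).le_of_opNorm_le
      (h.growQ' r0 r3 r2) ((1 - P t) x)
    have hm0 : 0 ≤ min t 1 := le_min ht zero_le_one
    have hm1 : min t 1 ≤ 1 := min_le_right _ _
    rw [_root_.smul_apply, norm_smul, e1, Real.norm_of_nonneg (by positivity)]
    have e3 := h.dhalf (e := Real.exp (K * 1 * ω)) ht (Real.exp_pos _)
    calc _ ≤ ((M * √K * Real.exp (K * 1 * ω))⁻¹ * 1 * μ t ^ (-γ - α)) *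
          (M * (deriv μ t / μ t) * Real.exp (K * 1 * ω) * μ t ^ α * ‖(1 - P t) x‖) := by gcongr
      _ = ((M * √K * Real.exp (K * 1 * ω))⁻¹ * (M * (deriv μ t / μ t) * Real.exp (K * 1 * ω))) *
          (μ t ^ (-γ - α) * μ t ^ α) * ‖(1 - P t) x‖ := by ring
      _ = ((M * √K * Real.exp (K * 1 * ω))⁻¹ * (M * (deriv μ t / μ t) * Real.exp (K * 1 * ω))) *
          μ t ^ (-γ) * ‖(1 - P t) x‖ := by rw [← Real.rpow_add hμ, sub_add_cancel]
      _ ≤ _ := by gcongr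

end AuxCtx

namespace AuxCtx
variable {E : Type*} [NormedAddCommGroup E] [NormedSpace ℝ E] [CompleteSpace E] {μ : ℝ → ℝ}
    {U V : ℝ → ℝ → E →L[ℝ] E} {P : ℝ → E →L[ℝ] E} {K M ω α : ℝ}

theorem stepP (h : AuxCtx μ U V P K M ω α) {γ : ℝ} (hγ : α < γ)
    (hyp : ∀ H : ℝ → E →L[ℝ] E, MemHClass μ P γ 2 H → ∃ ε D : ℝ, 0 ≤ ε ∧ 0 < D ∧
      ∀ s t, 0 ≤ s → s ≤ t → ∀ x : E, ∫ τ in s..t, ‖H τ (U τ s (P s x))‖ ^ 2 ≤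
      (√D * μ s ^ (ε + γ) * ‖x‖) ^ 2)
    (c : ℝ) (hc : 3 ≤ c) (T : ℕ → ℝ)
    (hT : ∀ n : ℕ, T n ∈ Set.Icc (2 * (n:ℝ) + c) (2 * n + c + 1)) :
    ∃ C F : ℝ, 0 ≤ C ∧ 0 ≤ F ∧ ∀ (n : ℕ) (s : ℝ), 0 ≤ s → s ≤ 2 * n →
      ‖(U (T n) s).comp (P s)‖ ≤ C * μ (T n) ^ (-(γ - α)) * μ s ^ F := by
  obtain ⟨r, hrc, hrT, hrb⟩ := aux_rho T c hT
  have hmem := h.memP γ (c + 2) r hrc (fun τ hτ => ⟨by linarith [(hrb τ hτ).1],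
    by linarith [(hrb τ hτ).2]⟩)
  obtain ⟨ε, D, hε, hD, hint⟩ := hyp _ hmem
  have hK := h.K1
  have hM := h.M1
  have hα := h.α0
  set c0 := (M * √K * Real.exp (K * (c + 2) * ω))⁻¹ with hc0
  have hc0p : 0 < c0 := by positivity
  refine ⟨c0⁻¹ * √D * Real.exp (K * (c + 1) * (γ - α)), ε + γ, by positivity, by linarith, ?_⟩
  intro n s hs hsn
  have hn0 : (0:ℝ) ≤ 2 * n := by positivity
  obtain ⟨hT1, hT2⟩ := hT n
  have hμs := h.pos hs
  have hμn := h.pos hn0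
  have hμT := h.pos (show 0 ≤ T n by linarith)
  refine ContinuousLinearMap.opNorm_le_bound _ (by positivity) fun x => ?_
  rw [ContinuousLinearMap.comp_apply]
  have hI := hint s (2 * n + 1) hs (by linarith) x
  have hw := aux_window_s17 (fun τ => ‖(fun τ => (c0 * μ τ ^ (γ - α)) •
      (U (r τ) τ).comp (P τ)) τ (U τ s (P s x))‖ ^ 2) s (2 * n + 1) (2 * n)
      ((c0 * μ (2 * n) ^ (γ - α) * ‖U (T n) s (P s x)‖) ^ 2) _
      ((h.HU _ hmem.1 hs (P s x)).norm.pow 2) (fun τ _ => by positivity) hsn le_rfl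
      (by
        intro τ hτ
        have hτ0 : 0 ≤ τ := hn0.trans hτ.1
        have e1 : P τ (U τ s (P s x)) = U τ s (P s x) := by
          have e2 := congrArg (fun A => A (P s x)) (h.hC.1 s τ hs (hsn.trans hτ.1))
          have e3 := congrArg (fun A => A x) (h.hP.1 s hs)
          simp only [ContinuousLinearMap.comp_apply] at e2 e3
          rw [e2, e3]
        have e4 : U (T n) τ (U τ s (P s x)) = U (T n) s (P s x) :=
          congrArg (fun A => A (P s x)) (h.hU.2.1 s τ (T n) hs (hsn.trans hτ.1) (by linarith [hτ.2]))
        have hμτ := h.pos hτ0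
        simp only [_root_.smul_apply, ContinuousLinearMap.comp_apply, e1, hrT n τ hτ, e4, norm_smul]
        rw [Real.norm_of_nonneg (by positivity)]
        have := h.mono _ _ hn0 hτ.1
        gcongr)
      hI
  have hw2 := (pow_le_pow_iff_left₀ (by positivity) (by positivity) two_ne_zero).1 hw
  have hr := h.ratio_rpow hn0 (show 2 * (n:ℝ) ≤ T n by linarith) (L := c + 1) (by linarith)
    (p := γ - α) (by linarith)
  rw [Real.div_rpow hμT.le hμn.le, div_le_iff₀ (by positivity)] at hr
  rw [Real.rpow_neg hμT.le]
  have hTp : 0 < μ (T n) ^ (γ - α) := by positivity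
  set y := ‖U (T n) s (P s x)‖
  have hy : 0 ≤ y := norm_nonneg _
  set e := Real.exp (K * (c + 1) * (γ - α))
  have he : 0 < e := Real.exp_pos _
  have h5 : c0 * (μ (T n) ^ (γ - α) * y) ≤ e * (√D * μ s ^ (ε + γ) * ‖x‖) := by
    calc c0 * (μ (T n) ^ (γ - α) * y) ≤ c0 * ((e * μ (2 * n) ^ (γ - α)) * y) := by gcongr
      _ = e * (c0 * μ (2 * n) ^ (γ - α) * y) := by ring
      _ ≤ _ := by gcongr
  rw [← le_div_iff₀' hc0p, ← le_div_iff₀' hTp] at h5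
  refine h5.trans (le_of_eq ?_)
  field_simp

theorem finalP (h : AuxCtx μ U V P K M ω α) {γ : ℝ} (hγ : α < γ)
    (hyp : ∀ H : ℝ → E →L[ℝ] E, MemHClass μ P γ 2 H → ∃ ε D : ℝ, 0 ≤ ε ∧ 0 < D ∧
      ∀ s t, 0 ≤ s → s ≤ t → ∀ x : E, ∫ τ in s..t, ‖H τ (U τ s (P s x))‖ ^ 2 ≤
      (√D * μ s ^ (ε + γ) * ‖x‖) ^ 2) :
    ∃ C F : ℝ, 0 ≤ C ∧ 0 ≤ F ∧ ∀ s t, 0 ≤ s → s ≤ t →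
      ‖(U t s).comp (P s)‖ ≤ C * (μ t / μ s) ^ (-(γ - α)) * μ s ^ F := by
  have hK := h.K1
  have hM := h.M1
  have hα := h.α0
  have hω := h.ω0
  have ha : 0 < γ - α := by linarith
  set a := γ - α with hadef
  let Bad : ℕ → ℝ → Prop := fun N t => ∃ s, 0 ≤ s ∧ s ≤ t - 5 ∧
    N * μ t ^ (-a) * μ s ^ (N:ℝ) < ‖(U t s).comp (P s)‖
  have hmono : ∀ (C F : ℝ) (N : ℕ) (t s : ℝ), 0 ≤ s → 0 ≤ t → C ≤ N → F ≤ N →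
      C * μ t ^ (-a) * μ s ^ F ≤ N * μ t ^ (-a) * μ s ^ (N:ℝ) := by
    intro C F N t s hs ht hC hF
    have := h.pos hs
    have := h.pos ht
    have := h.h1 s hs
    gcongr
  have hanti : ∀ N N' t, N ≤ N' → 0 ≤ t → Bad N' t → Bad N t := by
    rintro N N' t hN ht ⟨s, hs, hst, hb⟩
    refine ⟨s, hs, hst, lt_of_le_of_lt (hmono _ _ _ _ _ hs ht ?_ ?_) hb⟩ <;> exact_mod_cast hN
  have hsel : ∀ c : ℝ, 3 ≤ c → c ≤ 4 → ∃ N, ∀ n : ℕ,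
      ∀ t ∈ Set.Icc (2 * (n:ℝ) + c) (2 * n + c + 1), ¬ Bad N t := by
    intro c hc hc4
    refine aux_select Bad hanti c (by linarith) ?_ ?_
    · intro n
      have hn : (0:ℝ) ≤ 2 * n + c + 1 := by positivity
      set m := μ (2 * n + c + 1)
      have hm : 0 < m := h.pos hn
      obtain ⟨N, hN⟩ := exists_nat_ge (max (M * K * m ^ ω * m ^ a) α)
      refine ⟨N, fun t ht => ?_⟩
      rintro ⟨s, hs, hst, hb⟩
      have ht0 : 0 ≤ t := by linarith
      have hμt := h.pos ht0
      have hμs := h.pos hs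
      have hμs1 := h.h1 s hs
      have htm : μ t ≤ m := h.mono _ _ ht0 ht.2
      have b1 := h.gP s t hs (by linarith)
      have b2 := hmono _ _ N t s hs ht0 ((le_max_left _ _).trans hN) ((le_max_right _ _).trans hN)
      have b3 : M * (deriv μ s / μ s) * (μ t / μ s) ^ ω * μ s ^ α ≤
          M * K * m ^ ω * m ^ a * μ t ^ (-a) * μ s ^ α := by
        have b4 : μ t / μ s ≤ m := (div_le_self hμt.le hμs1).trans htm
        have b5 : 1 ≤ m ^ a * μ t ^ (-a) := by
          rw [Real.rpow_neg hμt.le, ← div_eq_mul_inv, one_le_div (by positivity)]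
          gcongr
        have := h.d0 s hs
        have := h.dK s hs
        calc M * (deriv μ s / μ s) * (μ t / μ s) ^ ω * μ s ^ α
            ≤ M * K * m ^ ω * μ s ^ α := by gcongr
          _ ≤ M * K * m ^ ω * μ s ^ α * (m ^ a * μ t ^ (-a)) :=
            le_mul_of_one_le_right (by positivity) b5
          _ = _ := by ring
      linarith
    · intro T hT
      obtain ⟨C, F, hC, hF, hb⟩ := h.stepP hγ hyp c hc T hT
      obtain ⟨N, hN⟩ := exists_nat_ge (max C F)
      refine ⟨N, fun n => ?_⟩
      rintro ⟨s, hs, hst, hbad⟩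
      have h1 := hb n s hs (by linarith [(hT n).2])
      have h2 := hmono C F N (T n) s hs (by linarith) ((le_max_left _ _).trans hN)
        ((le_max_right _ _).trans hN)
      linarith
  obtain ⟨N3, hN3⟩ := hsel 3 le_rfl (by norm_num)
  obtain ⟨N4, hN4⟩ := hsel 4 (by norm_num) le_rfl
  set N := max N3 N4
  have hgood : ∀ t, 5 ≤ t → ¬ Bad N t := by
    intro t ht hb
    have f1 := Nat.floor_le (a := (t - 3) / 2) (by linarith)
    have f2 := Nat.lt_floor_add_one ((t - 3) / 2)
    set n := ⌊(t - 3) / 2⌋₊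
    by_cases hcase : t ≤ 2 * n + 4
    · exact hN3 n t ⟨by linarith, by linarith⟩ (hanti _ _ _ (le_max_left _ _) (by linarith) hb)
    · exact hN4 n t ⟨by linarith, by linarith⟩ (hanti _ _ _ (le_max_right _ _) (by linarith) hb)
  set B := 1 + M * K * Real.exp (K * 5 * ω)
  have hB : 0 < B := by positivity
  refine ⟨max (N:ℝ) (B * Real.exp (K * 5 * a)), max (N:ℝ) α, le_max_of_le_right (by positivity),
    le_max_of_le_right hα, ?_⟩
  intro s t hs hst
  have ht := hs.trans hst
  have hμt := h.pos ht
  have hμs := h.pos hs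
  have hμs1 := h.h1 s hs
  by_cases hcase : s ≤ t - 5
  · have h1 : ‖(U t s).comp (P s)‖ ≤ N * μ t ^ (-a) * μ s ^ (N:ℝ) := by
      by_contra hlt
      exact hgood t (by linarith) ⟨s, hs, hcase, not_le.1 hlt⟩
    refine h1.trans ?_
    have h2 : μ t ^ (-a) ≤ (μ t / μ s) ^ (-a) :=
      Real.rpow_le_rpow_of_nonpos (by positivity) (div_le_self hμt.le hμs1) (by linarith)
    gcongr
    · exact le_max_left _ _
    · exact le_max_left _ _
  · have h1 := h.growP hs hst (L := 5) (by norm_num) (by linarith)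
    have h2 := h.ratio_rpow hs hst (L := 5) (by linarith) ha.le
    have h3 : 1 ≤ Real.exp (K * 5 * a) * (μ t / μ s) ^ (-a) := by
      rw [Real.rpow_neg (by positivity), ← div_eq_mul_inv, one_le_div (by positivity)]
      exact h2
    calc ‖(U t s).comp (P s)‖ ≤ B * μ s ^ α := h1
      _ ≤ B * μ s ^ α * (Real.exp (K * 5 * a) * (μ t / μ s) ^ (-a)) :=
        le_mul_of_one_le_right (by positivity) h3
      _ = (B * Real.exp (K * 5 * a)) * (μ t / μ s) ^ (-a) * μ s ^ α := by ring
      _ ≤ _ := by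
        gcongr
        · exact le_max_right _ _
        · exact le_max_right _ _

theorem finalQ (h : AuxCtx μ U V P K M ω α) {γ : ℝ} (hγ : α < γ)
    (hyp : ∀ H : ℝ → E →L[ℝ] E, MemHClass μ P γ 2 H → ∃ ε D : ℝ, 0 ≤ ε ∧ 0 < D ∧
      ∀ s t, 0 ≤ s → s ≤ t → ∀ x : E, ∫ τ in s..t, ‖H τ (U τ s (V s t ((1 - P t) x)))‖ ^ 2 ≤
      (√D * μ t ^ (ε - γ) * ‖x‖) ^ 2) :
    ∃ C F : ℝ, 0 ≤ C ∧ 0 ≤ F ∧ ∀ s t, 0 ≤ s → s ≤ t →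
      ‖(V s t).comp (1 - P t)‖ ≤ C * (μ t / μ s) ^ (-(γ + 2 * α)) * μ t ^ F := by
  have hmem := h.memQ γ
  obtain ⟨ε, D, hε, hD, hint⟩ := hyp _ hmem
  have hK := h.K1
  have hM := h.M1
  have hα := h.α0
  have hω := h.ω0
  have hb : 0 < γ + 2 * α := by linarith
  set b := γ + 2 * α with hbdef
  set c0 := (M * √K * Real.exp (K * 1 * ω))⁻¹ with hc0
  have hc0p : 0 < c0 := by positivity
  set B := 1 + M * K * Real.exp (K * 2 * ω)
  have hB : 0 < B := by positivity
  refine ⟨max (c0⁻¹ * B * √D * Real.exp (K * 2 * b)) (B * Real.exp (K * 2 * b)), ε + 2 * α,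
    le_max_of_le_right (by positivity), by positivity, ?_⟩
  intro s t hs hst
  have ht := hs.trans hst
  have hμt := h.pos ht
  have hμs := h.pos hs
  have hμt1 := h.h1 t ht
  by_cases hcase : s + 2 ≤ t
  · refine ContinuousLinearMap.opNorm_le_bound _ (by positivity) fun x => ?_
    rw [ContinuousLinearMap.comp_apply]
    have hs2 : 0 ≤ s + 2 := by linarith
    have hμ2 := h.pos hs2
    have hI := hint s t hs hst x
    have hw := aux_window_s17 (fun τ => ‖(fun τ => (c0 * min τ 1 * μ τ ^ (-γ - α)) •
        (V (max (τ - 1) 0) τ).comp (1 - P τ)) τ (U τ s (V s t ((1 - P t) x)))‖ ^ 2) s t (s + 1)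
        ((c0 * μ (s + 2) ^ (-b) * B⁻¹ * ‖V s t ((1 - P t) x)‖) ^ 2) _
        ((h.HU _ hmem.1 hs (V s t ((1 - P t) x))).norm.pow 2) (fun τ _ => by positivity)
        (by linarith) (by linarith)
        (by
          intro τ hτ
          have hτ1 := hτ.1
          have hτ2 := hτ.2
          have hτ0 : 0 ≤ τ := by linarith
          have hr0 : 0 ≤ τ - 1 := by linarith
          have hμτ := h.pos hτ0
          have hμr := h.pos hr0
          have hmax : max (τ - 1) 0 = τ - 1 := max_eq_left hr0
          have hmin : min τ 1 = 1 := min_eq_right (by linarith)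
          have e1 : V (τ - 1) τ ((1 - P τ) (U τ s (V s t ((1 - P t) x)))) =
              V (τ - 1) t ((1 - P t) x) := by
            rw [h.V1 hs (by linarith) (by linarith), h.V2 hr0 (by linarith) (by linarith)]
          have e2 : ‖V s t ((1 - P t) x)‖ ≤ B * μ (τ - 1) ^ α * ‖V (τ - 1) t ((1 - P t) x)‖ := by
            have := h.V2 hs (show s ≤ τ - 1 by linarith) (show τ - 1 ≤ t by linarith) x
            rw [← this]
            exact ((V s (τ - 1)).comp (1 - P (τ - 1))).le_of_opNorm_le
              (h.growQ hs (by linarith) (L := 2) (by norm_num) (by linarith)) _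
          simp only [_root_.smul_apply, ContinuousLinearMap.comp_apply, hmax, hmin, e1, norm_smul]
          rw [Real.norm_of_nonneg (by positivity)]
          have m1 : μ τ ≤ μ (s + 2) := h.mono _ _ hτ0 (by linarith)
          have m2 : μ (τ - 1) ≤ μ (s + 2) := h.mono _ _ hr0 (by linarith)
          have e3 : μ (s + 2) ^ (-b) * μ (τ - 1) ^ α ≤ μ τ ^ (-γ - α) := by
            calc μ (s + 2) ^ (-b) * μ (τ - 1) ^ α ≤ μ (s + 2) ^ (-b) * μ (s + 2) ^ α := by gcongr
              _ = μ (s + 2) ^ (-γ - α) := by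
                rw [← Real.rpow_add hμ2]; congr 1; rw [hbdef]; ring
              _ ≤ μ τ ^ (-γ - α) := Real.rpow_le_rpow_of_nonpos hμτ m1 (by linarith)
          apply pow_le_pow_left₀ (by positivity)
          calc c0 * μ (s + 2) ^ (-b) * B⁻¹ * ‖V s t ((1 - P t) x)‖
              ≤ c0 * μ (s + 2) ^ (-b) * B⁻¹ * (B * μ (τ - 1) ^ α * ‖V (τ - 1) t ((1 - P t) x)‖) := by
                gcongr
            _ = c0 * (μ (s + 2) ^ (-b) * μ (τ - 1) ^ α) * ‖V (τ - 1) t ((1 - P t) x)‖ := by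
                field_simp
            _ ≤ c0 * 1 * μ τ ^ (-γ - α) * ‖V (τ - 1) t ((1 - P t) x)‖ := by
                rw [mul_one]; gcongr)
        hI
    have hw2 := (pow_le_pow_iff_left₀ (by positivity) (by positivity) two_ne_zero).1 hw
    have hr := h.ratio_rpow hs (show s ≤ s + 2 by linarith) (L := 2) le_rfl hb.le
    rw [Real.div_rpow hμ2.le hμs.le, div_le_iff₀ (by positivity)] at hr
    set y := ‖V s t ((1 - P t) x)‖
    have hy : 0 ≤ y := norm_nonneg _
    set e := Real.exp (K * 2 * b)
    have he : 0 < e := Real.exp_pos _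
    have h6 : y ≤ c0⁻¹ * B * μ (s + 2) ^ b * (√D * μ t ^ (ε - γ) * ‖x‖) := by
      rw [Real.rpow_neg hμ2.le] at hw2
      have hp : 0 < c0 * (μ (s + 2) ^ b)⁻¹ * B⁻¹ := by positivity
      rw [← le_div_iff₀' hp] at hw2
      refine hw2.trans (le_of_eq ?_)
      field_simp
    have h7 : (μ t / μ s) ^ (-b) * μ t ^ (ε + 2 * α) = μ s ^ b * μ t ^ (ε - γ) := by
      rw [Real.rpow_neg (by positivity), Real.div_rpow hμt.le hμs.le, inv_div,
        div_mul_eq_mul_div, mul_div_assoc, ← Real.rpow_sub hμt]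
      congr 2
      rw [hbdef]; ring
    calc y ≤ c0⁻¹ * B * μ (s + 2) ^ b * (√D * μ t ^ (ε - γ) * ‖x‖) := h6
      _ ≤ c0⁻¹ * B * (e * μ s ^ b) * (√D * μ t ^ (ε - γ) * ‖x‖) := by gcongr
      _ = (c0⁻¹ * B * √D * e) * (μ s ^ b * μ t ^ (ε - γ)) * ‖x‖ := by ring
      _ = (c0⁻¹ * B * √D * e) * (μ t / μ s) ^ (-b) * μ t ^ (ε + 2 * α) * ‖x‖ := by
        rw [← h7]; ring
      _ ≤ _ := by
        gcongr
        exact le_max_left _ _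
  · have h1 := h.growQ hs hst (L := 2) (by norm_num) (by linarith)
    have h2 := h.ratio_rpow hs hst (L := 2) (by linarith) hb.le
    have h3 : 1 ≤ Real.exp (K * 2 * b) * (μ t / μ s) ^ (-b) := by
      rw [Real.rpow_neg (by positivity), ← div_eq_mul_inv, one_le_div (by positivity)]
      exact h2
    calc ‖(V s t).comp (1 - P t)‖ ≤ B * μ t ^ α := h1
      _ ≤ B * μ t ^ α * (Real.exp (K * 2 * b) * (μ t / μ s) ^ (-b)) :=
        le_mul_of_one_le_right (by positivity) h3
      _ = (B * Real.exp (K * 2 * b)) * (μ t / μ s) ^ (-b) * μ t ^ α := by ring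
      _ ≤ _ := by
        gcongr
        · exact le_max_right _ _
        · linarith

end AuxCtx

open RealInnerProductSpace in
/-- Corollary 3.8: the Hilbert space version of Theorem 3.7, with the Lyapunov function
given by a strongly continuous family of self-adjoint operators `W`. -/
theorem lyapunov_operator_implies_dichotomy
    {X : Type*} [NormedAddCommGroup X] [InnerProductSpace ℝ X] [CompleteSpace X]
    (μ : ℝ → ℝ) (Kμ : ℝ) (hgr : IsGrowthRate μ)
    (hdiff : ∀ t, 0 ≤ t → DifferentiableAt ℝ μ t)
    (hKμ : ∀ t, 0 ≤ t → deriv μ t / μ t ≤ Kμ)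
    (U V : ℝ → ℝ → X →L[ℝ] X) (P : ℝ → X →L[ℝ] X)
    (hU : IsEvolutionOperator U) (hP : IsProjectionValued P)
    (hC : CompatibleProjection U V P)
    (M ω α : ℝ) (hω : 0 < ω) (hα : 0 ≤ α) (hM : 1 ≤ M)
    (hG : ∀ t s, 0 ≤ t → 0 ≤ s → t ≠ s →
      ‖greenFunction U V P t s‖ ≤
        M * (deriv μ s / μ s) * (μ t / μ s) ^ (ω * Real.sign (t - s)) * μ s ^ α)
    (γ : ℝ) (hγ : α < γ)
    (hyp : ∀ H : ℝ → X →L[ℝ] X, MemHClass μ P γ 2 H →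
      ∃ (ε D : ℝ) (W : ℝ → X →L[ℝ] X), 0 ≤ ε ∧ 0 < D ∧
        (∀ x : X, ContinuousOn (fun t => W t x) (Set.Ici 0)) ∧
        (∀ t, 0 ≤ t → ContinuousLinearMap.adjoint (W t) = W t) ∧
        (∀ s t, 0 ≤ s → s ≤ t → ∀ x : X,
          ⟪ContinuousLinearMap.adjoint (U t s) (W t (U t s x)) +
              ∫ τ in s..t, ContinuousLinearMap.adjoint (U τ s)
                (ContinuousLinearMap.adjoint (H τ) (H τ (U τ s x))), x⟫ ≤
            ⟪W s x, x⟫) ∧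
        (∀ t, 0 ≤ t → ∀ x : X,
          0 ≤ ⟪W t (P t x), P t x⟫ ∧ ⟪W t ((1 - P t) x), (1 - P t) x⟫ ≤ 0 ∧
          μ t ^ (-(2 * γ)) * ⟪W t (P t x), P t x⟫ -
              μ t ^ (2 * γ) * ⟪W t ((1 - P t) x), (1 - P t) x⟫ ≤
            D * μ t ^ (2 * ε) * ‖x‖ ^ 2)) :
    NonuniformMuDichotomy μ U V P := by
  have h := aux_mkctx μ Kμ hgr hdiff hKμ U V P hU hP hC M ω α hω hα hM hG
  obtain ⟨C1, F1, hC1, hF1, b1⟩ := h.finalP hγ (fun H hH => by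
    obtain ⟨ε, D, W, hε, hD, -, -, hW1, hW2⟩ := hyp H hH
    exact ⟨ε, D, hε, hD, (h.lyap H W hH.1 hD hW1 hW2).1⟩)
  obtain ⟨C2, F2, hC2, hF2, b2⟩ := h.finalQ hγ (fun H hH => by
    obtain ⟨ε, D, W, hε, hD, -, -, hW1, hW2⟩ := hyp H hH
    exact ⟨ε, D, hε, hD, (h.lyap H W hH.1 hD hW1 hW2).2⟩)
  refine ⟨γ - α, γ + 2 * α, max F1 F2, max C1 1, max C2 1, by linarith, by linarith,
    le_max_of_le_left hF1, le_max_right _ _, le_max_right _ _, fun s t hs hst => ⟨?_, ?_⟩⟩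
  · have := h.pos hs
    have := h.pos (hs.trans hst)
    have h1 := h.h1 s hs
    refine (b1 s t hs hst).trans ?_
    gcongr
    · exact le_max_left _ _
    · exact le_max_left _ _
  · have := h.pos hs
    have := h.pos (hs.trans hst)
    have h1 := h.h1 t (hs.trans hst)
    refine (b2 s t hs hst).trans ?_
    gcongr
    · exact le_max_left _ _
    · exact le_max_right _ _
end
end
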